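/- arXiv:1403.3950 — 4 statements merged into one kernel-verified Lean document; each statement's English description precedes it below -/
import Mathlib

section
/- Let P be an irreducible, positive-recurrent Markov transition kernel with stationary probability distribution π on a countable state space 𝒳 equipped with a metric η and a distinguished point 𝟎, such that P has bounded jumps of size D and the set K_{2D} is finite. Then every adversarial process {X_n} (following P outside the bounded nonempty set K, with jumps bounded by D) is bounded in probability: lim_{L→∞} sup_n ℙ(η(X_n,𝟎) > L | X_0 = x_0) = 0. -/
open MeasureTheory ProbabilityTheory Filter Metric Set
open scoped ENNReal Topology

noncomputable def iterK {X : Type*} [MeasurableSpace X] (P : Kernel X X) : ℕ → Kernel X X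
  | 0 => Kernel.deterministic id measurable_id
  | n + 1 => P.comp (iterK P n)

noncomputable def tvDist {X : Type*} [MeasurableSpace X] (μ ν : Measure X) : ℝ≥0∞ :=
  ⨆ A : {s : Set X // MeasurableSet s}, (μ A.1 - ν A.1) ⊔ (ν A.1 - μ A.1)

def HarrisErgodic {X : Type*} [MeasurableSpace X] (P : Kernel X X) (π : Measure X) : Prop :=
  (∀ A : Set X, MeasurableSet A → ∫⁻ x, P x A ∂π = π A) ∧
    ∀ x, Tendsto (fun n => tvDist (iterK P n x) π) atTop (𝓝 0)

def IsAdversarial {X Ω : Type*} [MeasurableSpace X] [MetricSpace X] [MeasurableSpace Ω]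
    (P : Kernel X X) (K : Set X) (D : ℝ) (x₀ : X) (μ : Measure Ω) (Xp : ℕ → Ω → X) : Prop :=
  (∀ n, Measurable (Xp n)) ∧ (∀ ω, Xp 0 ω = x₀) ∧
  (∀ (n : ℕ) (A : Set X), MeasurableSet A → ∀ E : Set Ω,
      MeasurableSet[MeasurableSpace.comap (fun ω (i : Fin (n + 1)) => Xp i ω) inferInstance] E →
      μ (E ∩ {ω | Xp n ω ∉ K} ∩ {ω | Xp (n + 1) ω ∈ A}) =
        ∫⁻ ω in E ∩ {ω | Xp n ω ∉ K}, P (Xp n ω) A ∂μ) ∧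
  (∀ n : ℕ, μ ({ω | Xp n ω ∈ K} ∩ {ω | Xp (n + 1) ω ∉ cthickening D K}) = 0)

def BoundedInProb {X Ω : Type*} [MeasurableSpace Ω] [MetricSpace X]
    (μ : Measure Ω) (Xp : ℕ → Ω → X) (o : X) : Prop :=
  Tendsto (fun L : ℝ => ⨆ n, μ {ω | L < dist (Xp n ω) o}) atTop (𝓝 0)

def IsMarkovReal {X Ω : Type*} [MeasurableSpace X] [MeasurableSpace Ω]
    (P : Kernel X X) (ν : Measure X) (μ : Measure Ω) (Y : ℕ → Ω → X) : Prop :=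
  (∀ n, Measurable (Y n)) ∧ μ.map (Y 0) = ν ∧
  (∀ (n : ℕ) (A : Set X), MeasurableSet A → ∀ E : Set Ω,
      MeasurableSet[MeasurableSpace.comap (fun ω (i : Fin (n + 1)) => Y i ω) inferInstance] E →
      μ (E ∩ {ω | Y (n + 1) ω ∈ A}) = ∫⁻ ω in E, P (Y n ω) A ∂μ)

noncomputable def hitTime {X Ω : Type*} (Y : ℕ → Ω → X) (B : Set X) (ω : Ω) : ℝ≥0∞ :=
  ⨅ (n : ℕ) (_ : 1 ≤ n ∧ Y n ω ∈ B), (n : ℝ≥0∞)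

noncomputable def survMeas {X : Type*} [MeasurableSpace X] (P : Kernel X X) (B : Set X)
    (ν : Measure X) : ℕ → Measure X
  | 0 => ν
  | n + 1 => (((survMeas P B ν n).bind (fun x => P x)).restrict Bᶜ)

noncomputable def expKappaHit {X : Type*} [MeasurableSpace X] (P : Kernel X X) (C : Set X)
    (κ : ℝ≥0∞) (x : X) : ℝ≥0∞ :=
  (∑' n : ℕ, κ ^ (n + 1) * ((survMeas P C (Measure.dirac x) n).bind (fun z => P z)) C)
    + ⊤ * (1 - ∑' n : ℕ, ((survMeas P C (Measure.dirac x) n).bind (fun z => P z)) C)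

def IsSmallSet {X : Type*} [MeasurableSpace X] (P : Kernel X X) (C : Set X) : Prop :=
  ∃ ν : Measure X, IsProbabilityMeasure ν ∧ ∃ ε : ℝ≥0∞, 0 < ε ∧ ∃ n₀ : ℕ, 1 ≤ n₀ ∧
    ∀ x ∈ C, ∀ A : Set X, MeasurableSet A → ε * ν A ≤ iterK P n₀ x A

def GeomErgodic {X : Type*} [MeasurableSpace X] (P : Kernel X X) (π : Measure X) : Prop :=
  ∃ ρ : ℝ≥0∞, ρ < 1 ∧ ∃ ξ : X → ℝ≥0∞, Measurable ξ ∧ (∀ x, 1 ≤ ξ x) ∧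
    (∀ᵐ x ∂π, ξ x < ⊤) ∧ ∀ (n : ℕ) (x : X), tvDist (iterK P n x) π ≤ ξ x * ρ ^ n

section TabooStep

variable {X : Type*} [MeasurableSpace X] {P : Kernel X X} {B : Set X} {ν ν' π : Measure X}

/-- One step of the chain killed on entering `B`, acting on measures. -/
noncomputable def tabooStep (P : Kernel X X) (B : Set X) (ν : Measure X) : Measure X :=
  (ν.bind P).restrict Bᶜ

lemma tabooStep_apply (hB : MeasurableSet B) {A : Set X} (hA : MeasurableSet A) :
    tabooStep P B ν A = ∫⁻ x, P x (A ∩ Bᶜ) ∂ν := by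
  rw [tabooStep, Measure.restrict_apply hA, Measure.bind_apply (hA.inter hB.compl) P.aemeasurable]

lemma tabooStep_add : tabooStep P B (ν + ν') = tabooStep P B ν + tabooStep P B ν' := by
  simp [tabooStep]

lemma tabooStep_smul (c : ℝ≥0∞) : tabooStep P B (c • ν) = c • tabooStep P B ν := by
  simp [tabooStep, Measure.restrict_smul]

lemma tabooStep_zero : tabooStep P B 0 = 0 := by
  simp [tabooStep]

lemma tabooStep_sum {ι : Type*} (s : Finset ι) (f : ι → Measure X) :
    tabooStep P B (∑ i ∈ s, f i) = ∑ i ∈ s, tabooStep P B (f i) := by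
  classical
  induction s using Finset.induction_on with
  | empty => simp [tabooStep_zero]
  | insert a s ha ih => simp [Finset.sum_insert ha, tabooStep_add, ih]

lemma survMeas_succ (n : ℕ) :
    survMeas P B ν (n + 1) = tabooStep P B (survMeas P B ν n) := rfl

lemma isFiniteMeasure_survMeas [IsMarkovKernel P] [IsFiniteMeasure ν] (n : ℕ) :
    IsFiniteMeasure (survMeas P B ν n) := by
  induction n with
  | zero => simpa [survMeas]
  | succ n ih => rw [survMeas_succ, tabooStep]; infer_instance

lemma measure_mul_le_lintegral_kernel [MeasurableSingletonClass X] (x : X) {A : Set X}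
    (hA : MeasurableSet A) : ν {x} * P x A ≤ ∫⁻ z, P z A ∂ν := by
  calc ν {x} * P x A = ∫⁻ z in {x}, P z A ∂ν := by
        rw [lintegral_singleton' (P.measurable_coe hA), mul_comm]
    _ ≤ ∫⁻ z, P z A ∂ν := setLIntegral_le_lintegral _ _

lemma survMeas_stationary (hB : MeasurableSet B) (hstat : π.bind P = π) (n : ℕ) :
    survMeas P B (π.restrict Bᶜ) n =
      survMeas P B (tabooStep P B (π.restrict B)) n + survMeas P B (π.restrict Bᶜ) (n + 1) := by
  induction n with
  | zero =>
    rw [survMeas_succ]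
    simp only [survMeas]
    rw [← tabooStep_add, Measure.restrict_add_restrict_compl hB, tabooStep, hstat]
  | succ n ih =>
    rw [survMeas_succ, survMeas_succ (n + 1), survMeas_succ n, ← tabooStep_add, ← ih]

lemma iterK_compl_eq_zero_of_absorbing {S : Set X} (hS : MeasurableSet S)
    (habs : ∀ x ∈ S, P x Sᶜ = 0) {x : X} (hx : x ∈ S) (n : ℕ) : iterK P n x Sᶜ = 0 := by
  induction n with
  | zero => simp [iterK, Kernel.deterministic_apply, hS, hx]
  | succ n ih =>
    rw [iterK, Kernel.comp_apply' _ _ _ hS.compl, lintegral_eq_zero_iff (P.measurable_coe hS.compl)]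
    filter_upwards [measure_eq_zero_iff_ae_notMem.1 ih] with z hz
    exact habs z (not_not.1 hz)

variable [Countable X] [MeasurableSingletonClass X]

/-- Under irreducibility every state outside `B` is charged by some excursion out of `B`. -/
lemma exists_survMeas_singleton_pos (hirr : ∀ x y : X, ∃ n : ℕ, 1 ≤ n ∧ 0 < iterK P n x {y})
    (hpos : ∀ x : X, 0 < π {x}) (hne : B.Nonempty) {y : X} (hy : y ∉ B) :
    ∃ n, 0 < survMeas P B (tabooStep P B (π.restrict B)) n {y} := by
  set σ := tabooStep P B (π.restrict B)
  have hmeas (A : Set X) : MeasurableSet A := A.to_countable.measurableSet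
  set S : Set X := B ∪ {z | ∃ n, 0 < survMeas P B σ n {z}} with hSdef
  have habs : ∀ x ∈ S, P x Sᶜ = 0 := by
    intro x hx
    rw [← biUnion_of_singleton Sᶜ, measure_biUnion_null_iff (to_countable _)]
    intro z hz
    by_contra hxz
    have hzB : {z} ∩ Bᶜ = ({z} : Set X) :=
      inter_eq_left.2 (singleton_subset_iff.2 fun h => hz (Or.inl h))
    rcases hx with hx | ⟨n, hn⟩
    · refine hz (Or.inr ⟨0, ?_⟩)
      rw [survMeas, tabooStep_apply (hmeas B) (hmeas _), hzB]
      refine lt_of_lt_of_le ?_ (measure_mul_le_lintegral_kernel x (hmeas _))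
      rw [Measure.restrict_apply (hmeas _), inter_eq_left.2 (singleton_subset_iff.2 hx)]
      exact ENNReal.mul_pos (hpos x).ne' hxz
    · refine hz (Or.inr ⟨n + 1, ?_⟩)
      rw [survMeas_succ, tabooStep_apply (hmeas B) (hmeas _), hzB]
      exact lt_of_lt_of_le (ENNReal.mul_pos hn.ne' hxz)
        (measure_mul_le_lintegral_kernel x (hmeas _))
  obtain ⟨b, hb⟩ := hne
  obtain ⟨n, -, hn⟩ := hirr b y
  have hyS : y ∈ S := by
    by_contra hyS
    exact hn.ne' (measure_mono_null (singleton_subset_iff.2 hyS)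
      (iterK_compl_eq_zero_of_absorbing (hmeas S) habs (Or.inl hb) n))
  exact hyS.resolve_left hy

variable [IsMarkovKernel P] [IsFiniteMeasure π]

lemma exists_finite_dirac_add_tabooStep_le (hstat : π.bind P = π)
    (hirr : ∀ x y : X, ∃ n : ℕ, 1 ≤ n ∧ 0 < iterK P n x {y})
    (hpos : ∀ x : X, 0 < π {x}) (hne : B.Nonempty) {y : X} (hy : y ∉ B) :
    ∃ G : Measure X, IsFiniteMeasure G ∧ Measure.dirac y + tabooStep P B G ≤ G := by
  obtain ⟨n, hn⟩ := exists_survMeas_singleton_pos hirr hpos hne hy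
  set σ := survMeas P B (tabooStep P B (π.restrict B)) n
  have hfinite := isFiniteMeasure_survMeas (P := P) (B := B) (ν := π.restrict Bᶜ) n
  refine ⟨(σ {y})⁻¹ • survMeas P B (π.restrict Bᶜ) n,
    Measure.smul_finite _ (ENNReal.inv_ne_top.2 hn.ne'), ?_⟩
  conv_rhs => rw [survMeas_stationary B.to_countable.measurableSet hstat, smul_add]
  rw [tabooStep_smul, ← survMeas_succ]
  gcongr
  have hσ : σ {y} ≠ ⊤ := by
    have : IsFiniteMeasure (tabooStep P B (π.restrict B)) := by rw [tabooStep]; infer_instance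
    have : IsFiniteMeasure σ := isFiniteMeasure_survMeas n
    exact measure_ne_top _ _
  refine Measure.le_iff.2 fun A hA => ?_
  by_cases hyA : y ∈ A
  · rw [Measure.dirac_apply_of_mem hyA, Measure.smul_apply, smul_eq_mul,
      ← ENNReal.inv_mul_cancel hn.ne' hσ]
    gcongr
    simpa using hyA
  · simp [Measure.dirac_apply' _ hA, hyA]

/-- A finite measure dominating the occupation measure of excursions out of `B` that start
from the finite set `F`. -/
lemma exists_finite_sum_dirac_add_tabooStep_le (hstat : π.bind P = π)
    (hirr : ∀ x y : X, ∃ n : ℕ, 1 ≤ n ∧ 0 < iterK P n x {y})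
    (hpos : ∀ x : X, 0 < π {x}) (hne : B.Nonempty) (F : Finset X) (hF : ∀ y ∈ F, y ∉ B) :
    ∃ G : Measure X, IsFiniteMeasure G ∧
      ∑ y ∈ F, Measure.dirac y + tabooStep P B G ≤ G := by
  have h (y : X) : ∃ G : Measure X, IsFiniteMeasure G ∧
      (y ∈ F → Measure.dirac y + tabooStep P B G ≤ G) := by
    by_cases hy : y ∈ F
    · obtain ⟨G, h1, h2⟩ := exists_finite_dirac_add_tabooStep_le hstat hirr hpos hne (hF y hy)
      exact ⟨G, h1, fun _ => h2⟩
    · exact ⟨0, inferInstance, fun h => absurd h hy⟩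
  choose G hfinite hle using h
  refine ⟨∑ y ∈ F, G y, inferInstance, ?_⟩
  rw [tabooStep_sum, ← Finset.sum_add_distrib]
  exact Finset.sum_le_sum hle

end TabooStep

section Adversarial

variable {X Ω : Type*} [MeasurableSpace X] [MetricSpace X] [Countable X]
  [MeasurableSingletonClass X] [MeasurableSpace Ω]
  {P : Kernel X X} {K : Set X} {D : ℝ} {x₀ : X} {μ : Measure Ω}
  {Xp : ℕ → Ω → X}

lemma IsAdversarial.map_restrict_compl_le [IsProbabilityMeasure μ]
    (hadv : IsAdversarial P K D x₀ μ Xp) (hx₀ : x₀ ∈ K)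
    {F : Finset X} (hF : cthickening D K \ K ⊆ F) {G : Measure X}
    (hG : ∑ y ∈ F, Measure.dirac y + tabooStep P K G ≤ G) (n : ℕ) :
    (μ.map (Xp n)).restrict Kᶜ ≤ G := by
  obtain ⟨hmeas, h0, hout, hin⟩ := hadv
  have hms (A : Set X) : MeasurableSet A := A.to_countable.measurableSet
  induction n with
  | zero =>
    have : (μ.map (Xp 0)).restrict Kᶜ = 0 := by
      rw [Measure.restrict_eq_zero, Measure.map_apply (hmeas 0) (hms _)]
      simp [preimage, h0, hx₀]
    rw [this]
    exact Measure.zero_le _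
  | succ n ih =>
    refine le_trans (Measure.le_iff.2 fun A hA => ?_) hG
    rw [Measure.restrict_apply hA, Measure.map_apply (hmeas _) (hms _), Measure.add_apply,
      tabooStep_apply (hms K) hA]
    have hsplit : Xp (n + 1) ⁻¹' (A ∩ Kᶜ) ⊆
        ({ω | Xp n ω ∈ K} ∩ {ω | Xp (n + 1) ω ∉ cthickening D K} ∪
          {ω | Xp (n + 1) ω ∈ A ∩ F}) ∪
        (univ ∩ {ω | Xp n ω ∉ K} ∩ {ω | Xp (n + 1) ω ∈ A ∩ Kᶜ}) := by
      intro ω hω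
      by_cases h1 : Xp n ω ∈ K
      · by_cases h2 : Xp (n + 1) ω ∈ cthickening D K
        · exact Or.inl (Or.inr ⟨hω.1, hF ⟨h2, hω.2⟩⟩)
        · exact Or.inl (Or.inl ⟨h1, h2⟩)
      · exact Or.inr ⟨⟨mem_univ _, h1⟩, hω⟩
    refine (measure_mono hsplit).trans ((measure_union_le _ _).trans (add_le_add ?_ ?_))
    · refine (measure_union_le _ _).trans ?_
      rw [hin n, zero_add, Measure.finsetSum_apply]
      rcases (A ∩ (F : Set X)).eq_empty_or_nonempty with hempty | ⟨y, hyA, hyF⟩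
      · simp [hempty]
      · calc μ {ω | Xp (n + 1) ω ∈ A ∩ F} ≤ 1 := prob_le_one
          _ = Measure.dirac y A := (Measure.dirac_apply_of_mem hyA).symm
          _ ≤ ∑ y ∈ F, Measure.dirac y A :=
            Finset.single_le_sum (f := fun y => Measure.dirac y A) (fun _ _ => zero_le) hyF
    · rw [hout n _ (hms _) univ MeasurableSet.univ, univ_inter]
      calc ∫⁻ ω in {ω | Xp n ω ∉ K}, P (Xp n ω) (A ∩ Kᶜ) ∂μ
          = ∫⁻ x in Kᶜ, P x (A ∩ Kᶜ) ∂(μ.map (Xp n)) :=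
            (setLIntegral_map (hms Kᶜ) (P.measurable_coe (hms (A ∩ Kᶜ))) (hmeas n)).symm
        _ ≤ ∫⁻ x, P x (A ∩ Kᶜ) ∂G := lintegral_mono' ih le_rfl

lemma boundedInProb_of_map_restrict_compl_le (hmeas : ∀ n, Measurable (Xp n))
    (hK : Bornology.IsBounded K) {G : Measure X} [IsFiniteMeasure G]
    (hG : ∀ n, (μ.map (Xp n)).restrict Kᶜ ≤ G) (o : X) : BoundedInProb μ Xp o := by
  have hms (A : Set X) : MeasurableSet A := A.to_countable.measurableSet
  have hlim : Tendsto (fun L : ℝ => G {x | L < dist x o}) atTop (𝓝 0) := by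
    have hempty : ⋂ L : ℝ, {x : X | L < dist x o} = ∅ :=
      eq_empty_of_forall_notMem fun x hx => lt_irrefl (dist x o) (mem_iInter.1 hx (dist x o))
    rw [← measure_empty (μ := G), ← hempty]
    exact tendsto_measure_iInter_atTop (fun _ => (hms _).nullMeasurableSet)
      (fun a b hab x hx => lt_of_le_of_lt hab hx) ⟨0, measure_ne_top _ _⟩
  obtain ⟨R, hR⟩ := hK.subset_closedBall o
  refine tendsto_of_tendsto_of_tendsto_of_le_of_le' tendsto_const_nhds hlim
    (Eventually.of_forall fun _ => zero_le) ?_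
  filter_upwards [eventually_ge_atTop R] with L hL
  refine iSup_le fun n => ?_
  refine le_trans (le_of_eq ?_) (hG n {x | L < dist x o})
  have hsub : {x : X | L < dist x o} ⊆ Kᶜ := fun x hx hxK =>
    absurd (mem_closedBall.1 (hR hxK)) (not_le.2 (lt_of_le_of_lt hL hx))
  rw [Measure.restrict_apply (hms _), inter_eq_left.2 hsub, Measure.map_apply (hmeas n) (hms _)]
  rfl

end Adversarial

/-- Proposition 2 (discreteprop): if P is an irreducible positive-recurrent Markov kernel
with stationary probability distribution π on a countable state space such that K_{2D} is
finite, then every adversarial process is bounded in probability. -/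
theorem adversarial_bounded_of_countable
    {𝒳 : Type*} [MeasurableSpace 𝒳] [MetricSpace 𝒳] [BorelSpace 𝒳] [Countable 𝒳] (o : 𝒳)
    (P : Kernel 𝒳 𝒳) [IsMarkovKernel P] (π : Measure 𝒳) [IsProbabilityMeasure π]
    -- π is stationary for P
    (hstat : ∀ A : Set 𝒳, MeasurableSet A → ∫⁻ x, P x A ∂π = π A)
    -- P is irreducible
    (hirr : ∀ x y : 𝒳, ∃ n : ℕ, 1 ≤ n ∧ 0 < iterK P n x {y})
    -- positive recurrence: the stationary probability π charges every state
    (hpos : ∀ x : 𝒳, 0 < π {x})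
    (D : ℝ) (hD : 0 < D) (hjump : ∀ x, P x {y | dist x y ≤ D} = 1)
    (K : Set 𝒳) (hKmeas : MeasurableSet K) (hKne : K.Nonempty)
    (hKbdd : Bornology.IsBounded K)
    -- K_{2D} is finite
    (hfin : (cthickening (2 * D) K).Finite)
    -- the adversarial process
    {Ω : Type*} [MeasurableSpace Ω] (μ : Measure Ω) [IsProbabilityMeasure μ]
    (x₀ : 𝒳) (hx₀ : x₀ ∈ K) (Xp : ℕ → Ω → 𝒳)
    (hadv : IsAdversarial P K D x₀ μ Xp) :
    BoundedInProb μ Xp o := by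
  have hstat' : π.bind P = π := by
    ext A hA
    rw [Measure.bind_apply hA P.aemeasurable, hstat A hA]
  have hsub : cthickening D K \ K ⊆ cthickening (2 * D) K :=
    sdiff_subset.trans (cthickening_mono (by linarith) K)
  obtain ⟨F, hF⟩ := (hfin.subset hsub).exists_finset_coe
  obtain ⟨G, hGfin, hG⟩ := exists_finite_sum_dirac_add_tabooStep_le hstat' hirr hpos hKne F
    fun y hy => ((hF ▸ Finset.mem_coe.2 hy : y ∈ cthickening D K \ K)).2
  exact boundedInProb_of_map_restrict_compl_le hadv.1 hKbdd
    (hadv.map_restrict_compl_le hx₀ hF.ge hG) o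
end

section
/- There exist: a countable closed subset 𝒳 of ℝ² (with the Euclidean metric η and a point 𝟎 ∈ 𝒳), a Markov transition kernel P on 𝒳 that is Harris ergodic with stationary probability distribution π, has bounded jumps of size D < ∞, and satisfies the strong continuity condition that for every x ∈ 𝒳 and ε > 0 there is δ > 0 with ‖P(y,·) − P(x,·)‖_TV < ε whenever η(x,y) < δ; a bounded nonempty subset K of 𝒳; and an adversarial process {X_n} (starting in K, following P outside K, with jumps bounded by D) that is NOT bounded in probability. -/
open MeasureTheory ProbabilityTheory Filter Metric Set
open scoped ENNReal Topology

/-- A time-inhomogeneous Markov chain started at a deterministic point, with respect to its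
natural filtration. -/
theorem exists_markov_chain {X : Type} [MeasurableSpace X] [MeasurableSingletonClass X]
    (Q : ℕ → Kernel X X) [∀ n, IsMarkovKernel (Q n)] (x₀ : X) :
    ∃ (μ : Measure (ℕ → X)) (Y : ℕ → (ℕ → X) → X), IsProbabilityMeasure μ ∧
      (∀ n, Measurable (Y n)) ∧ (∀ ω, Y 0 ω = x₀) ∧
      ∀ (n : ℕ) (A : Set X), MeasurableSet A → ∀ E : Set (ℕ → X),
        MeasurableSet[MeasurableSpace.comap (fun ω (i : Fin (n + 1)) => Y i ω) inferInstance] E →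
        μ (E ∩ {ω | Y (n + 1) ω ∈ A}) = ∫⁻ ω in E, Q n (Y n ω) A ∂μ := by
  let κ : (n : ℕ) → Kernel (Π _ : Finset.Iic n, X) X := fun n =>
    (Q n).comap (fun h => h ⟨n, Finset.mem_Iic.2 le_rfl⟩) (by fun_prop)
  have hκ : ∀ n, IsMarkovKernel (κ n) := fun n => by dsimp only [κ]; infer_instance
  let μ : Measure (ℕ → X) := Kernel.trajMeasure (X := fun _ => X) (Measure.dirac x₀) κ
  have hμ : IsProbabilityMeasure μ := by dsimp only [μ]; infer_instance
  have h0 : ∀ᵐ ω ∂μ, ω 0 = x₀ := by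
    have hmap : μ.map (fun ω => ω 0) = Measure.dirac x₀ := by
      have h1 : (fun ω : ℕ → X => ω 0) = (fun h => h ⟨0, Finset.mem_Iic.2 le_rfl⟩) ∘
          Preorder.frestrictLe (π := fun _ => X) 0 := rfl
      rw [h1, ← Measure.map_map (by fun_prop) (by fun_prop)]
      dsimp only [μ, Kernel.trajMeasure]
      rw [Measure.map_comp _ _ (by fun_prop), Kernel.traj_map_frestrictLe, Kernel.partialTraj_self,
        Measure.id_comp, Measure.map_map (by fun_prop) (by fun_prop)]
      exact Measure.map_id
    have h2 : ∀ᵐ x ∂μ.map (fun ω => ω 0), x = x₀ := by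
      rw [hmap, ae_dirac_eq]; exact rfl
    exact ae_of_ae_map (measurable_pi_apply 0).aemeasurable h2
  let Y : ℕ → (ℕ → X) → X := fun n ω => if n = 0 then x₀ else ω n
  have hYm : ∀ n, Measurable (Y n) := fun n => by
    by_cases h : n = 0
    · simp [Y, h]
    · simp only [Y, h, if_false]; fun_prop
  have hY : ∀ᵐ ω ∂μ, ∀ n, Y n ω = ω n := by
    filter_upwards [h0] with ω hω n
    by_cases h : n = 0
    · subst h; simp [Y, hω]
    · simp [Y, h]
  refine ⟨μ, Y, hμ, hYm, fun ω => by simp [Y], ?_⟩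
  rintro n A hA E ⟨S, hS, rfl⟩
  let g : (Π _ : Finset.Iic n, X) → Fin (n + 1) → X := fun h i =>
    if (i : ℕ) = 0 then x₀ else h ⟨i, Finset.mem_Iic.2 (Nat.lt_succ_iff.1 i.2)⟩
  have hg : Measurable g := by
    refine measurable_pi_lambda _ fun i => ?_
    by_cases h : (i : ℕ) = 0
    · simp only [g, h, if_true]; exact measurable_const
    · simp only [g, h, if_false]; fun_prop
  have hT : MeasurableSet (g ⁻¹' S) := hg hS
  have key := congrArg (fun m => m ((g ⁻¹' S) ×ˢ A))
    (Kernel.map_frestrictLe_trajMeasure_compProd_eq_map_trajMeasure (X := fun _ => X)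
      (μ₀ := Measure.dirac x₀) (κ := κ) (a := n))
  have hm : Measurable
      (fun x : ℕ → X => (Preorder.frestrictLe (π := fun _ => X) n x, x (n + 1))) := by
    fun_prop
  simp only [Measure.compProd_apply_prod hT hA, Measure.map_apply hm (hT.prod hA)] at key
  rw [setLIntegral_map hT ((κ n).measurable_coe hA) (by fun_prop)] at key
  have e : (fun ω (i : Fin (n + 1)) => Y i ω) ⁻¹' S =
      Preorder.frestrictLe (π := fun _ => X) n ⁻¹' (g ⁻¹' S) := rfl
  calc _ = μ ((fun x : ℕ → X => (Preorder.frestrictLe (π := fun _ => X) n x, x (n + 1))) ⁻¹'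
        ((g ⁻¹' S) ×ˢ A)) := rfl
    _ = _ := key.symm
    _ = _ := by
      rw [e]
      refine lintegral_congr_ae (ae_restrict_of_ae ?_)
      filter_upwards [hY] with ω hω
      rw [hω n]
      rfl

/-- Mean holding time at the tip `(i, i)` of the `i`-th ray. -/
def tipTime (i : ℕ) : ℕ := (2 * (i + 1)) ^ i

/-- Probability of not falling back to the axis; states are pairs (distance, ray), and ray `0` is
the axis. -/
noncomputable def moveProb (s : ℕ × ℕ) : ℝ :=
  if s.1 = 0 ∨ s.2 < s.1 then 0
  else if s.1 = s.2 then 1 - 1 / (tipTime s.2 : ℝ) else 1 / ((s.2 : ℝ) + 1)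

/-- One step outwards along the ray; the tip stays put. -/
def moveTo (s : ℕ × ℕ) : ℕ × ℕ := if s.1 < s.2 then (s.1 + 1, s.2) else s

/-- One step inwards, onto the axis. -/
def fallTo (s : ℕ × ℕ) : ℕ × ℕ := (s.1 - 1, 0)

/-- Upper bound for the expected time to reach the origin. -/
noncomputable def returnBound (s : ℕ × ℕ) : ℝ :=
  if s.2 = 0 then (s.1 : ℝ) else s.1 + tipTime s.2

/-- Upper bound for the expected time to reach the tip of ray `i`, when every visit to the origin
is followed by a jump to the start of that ray. -/
noncomputable def tipBound (i : ℕ) (s : ℕ × ℕ) : ℝ :=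
  tipTime i + returnBound s -
    if s.2 = i ∧ 1 ≤ s.1 ∧ s.1 ≤ i then (tipTime i : ℝ) + (2 * (i + 1)) ^ s.1 else 0

theorem one_le_tipTime (i : ℕ) : 1 ≤ tipTime i := Nat.one_le_pow _ _ (by omega)

theorem two_le_tipTime {i : ℕ} (hi : i ≠ 0) : 2 ≤ tipTime i :=
  le_trans (by omega) (Nat.le_self_pow hi _)

theorem tipTime_mono : Monotone tipTime := fun i j h =>
  (Nat.pow_le_pow_left (by omega) i).trans (Nat.pow_le_pow_right (by omega) h)

theorem moveProb_mem (s : ℕ × ℕ) : moveProb s ∈ Icc (0 : ℝ) 1 := by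
  have h1 : (1 : ℝ) ≤ tipTime s.2 := by exact_mod_cast one_le_tipTime s.2
  unfold moveProb
  split_ifs
  · simp
  · have : 1 / (tipTime s.2 : ℝ) ≤ 1 := by rw [div_le_one (by linarith)]; exact h1
    have : 0 ≤ 1 / (tipTime s.2 : ℝ) := by positivity
    constructor <;> linarith
  · refine ⟨by positivity, ?_⟩
    rw [div_le_one (by positivity)]
    linarith [(Nat.cast_nonneg s.2 : (0 : ℝ) ≤ s.2)]

theorem moveProb_axis (k : ℕ) : moveProb (k, 0) = 0 := by
  unfold moveProb
  rw [if_pos]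
  by_cases h : k = 0
  · exact Or.inl h
  · exact Or.inr (Nat.pos_of_ne_zero h)

theorem moveProb_le {k j : ℕ} (h : k < j) : moveProb (k, j) ≤ 1 / ((j : ℝ) + 1) := by
  unfold moveProb
  split_ifs with h1 h2
  · positivity
  · simp at h2; omega
  · exact le_rfl

theorem returnBound_nonneg (s : ℕ × ℕ) : 0 ≤ returnBound s := by
  unfold returnBound; split_ifs <;> positivity

theorem returnBound_drift {s : ℕ × ℕ} (hs : s ≠ (0, 0)) :
    moveProb s * returnBound (moveTo s) + (1 - moveProb s) * returnBound (fallTo s) + 1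
      ≤ returnBound s := by
  obtain ⟨k, j⟩ := s
  have hN1 : (1 : ℝ) ≤ tipTime j := by exact_mod_cast one_le_tipTime j
  unfold moveProb moveTo fallTo returnBound
  rcases Nat.eq_zero_or_pos k with rfl | hk
  · have hj : j ≠ 0 := by rintro rfl; exact hs rfl
    simp [hj, hN1]
  have hk' : ((k - 1 : ℕ) : ℝ) = k - 1 := by push_cast [hk]; ring
  rcases lt_trichotomy k j with h | rfl | h
  · have hj : j ≠ 0 := by omega
    have hN : (2 : ℝ) ≤ tipTime j := by exact_mod_cast two_le_tipTime hj
    simp only [hk.ne', h.not_gt, h, h.ne, hj, hk', or_self, if_true, if_false]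
    have hj1 : (1 : ℝ) ≤ j := by exact_mod_cast Nat.one_le_iff_ne_zero.2 hj
    have hp : 1 / ((j : ℝ) + 1) ≤ 1 / 2 := one_div_le_one_div_of_le (by norm_num) (by linarith)
    push_cast
    nlinarith
  · have hp : 1 / (tipTime k : ℝ) * tipTime k = 1 := one_div_mul_cancel (by positivity)
    have hp0 : 0 ≤ 1 / (tipTime k : ℝ) := by positivity
    simp only [hk.ne', lt_irrefl, hk', or_self, if_true, if_false]
    nlinarith
  · simp only [h, h.not_gt, hk', or_true, if_true]
    split_ifs <;> linarith

theorem tipBound_le (i : ℕ) (s : ℕ × ℕ) : tipBound i s ≤ tipTime i + returnBound s := by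
  unfold tipBound
  split_ifs
  · have : (0 : ℝ) ≤ tipTime i + (2 * (i + 1)) ^ s.1 := by positivity
    linarith
  · linarith

theorem tipBound_nonneg (i : ℕ) (s : ℕ × ℕ) : 0 ≤ tipBound i s := by
  have h0 := returnBound_nonneg s
  unfold tipBound
  split_ifs with h
  · obtain ⟨h1, h2, h3⟩ := h
    have hi : i ≠ 0 := by omega
    have : ((2 * ((i : ℝ) + 1)) ^ s.1) ≤ tipTime i := by
      unfold tipTime
      push_cast
      exact pow_le_pow_right₀ (by linarith [(Nat.cast_nonneg i : (0 : ℝ) ≤ i)]) h3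
    simp only [returnBound, h1, hi, if_false] at *
    linarith [(Nat.cast_nonneg s.1 : (0 : ℝ) ≤ s.1)]
  · have : (0 : ℝ) ≤ tipTime i := by positivity
    linarith

theorem tipBound_start {i : ℕ} (hi : i ≠ 0) : tipBound i (1, i) + 1 ≤ tipBound i (0, 0) := by
  have : 1 ≤ i := Nat.one_le_iff_ne_zero.2 hi
  simp [tipBound, returnBound, hi, this]
  have : (1 : ℝ) ≤ i := by exact_mod_cast this
  linarith

theorem tipBound_drift {i : ℕ} {s : ℕ × ℕ} (hs : s ≠ (0, 0)) :
    moveProb s * tipBound i (moveTo s) + (1 - moveProb s) * tipBound i (fallTo s) + 1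
      ≤ tipBound i s + if s = (i, i) then 2 else 0 := by
  by_cases h : s.2 = i ∧ 1 ≤ s.1 ∧ s.1 ≤ i
  · obtain ⟨k, j⟩ := s
    obtain ⟨rfl, hk, hkj⟩ := h
    dsimp only at hk hkj
    have hN1 : (1 : ℝ) ≤ tipTime j := by exact_mod_cast one_le_tipTime j
    have hk' : ((k - 1 : ℕ) : ℝ) = k - 1 := by push_cast [hk]; ring
    have hj : j ≠ 0 := by omega
    have hk0 : k ≠ 0 := by omega
    unfold moveProb moveTo fallTo tipBound returnBound
    rcases hkj.lt_or_eq with h | rfl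
    · have hj1 : (1 : ℝ) ≤ j := by exact_mod_cast Nat.one_le_iff_ne_zero.2 hj
      have hp : 1 / ((j : ℝ) + 1) ≤ 1 / 2 := one_div_le_one_div_of_le (by norm_num) (by linarith)
      have hc : (1 : ℝ) ≤ (2 * ((j : ℝ) + 1)) ^ k := one_le_pow₀ (by linarith)
      have hpc : 1 / ((j : ℝ) + 1) * (2 * ((j : ℝ) + 1)) ^ (k + 1) = 2 * (2 * ((j : ℝ) + 1)) ^ k := by
        field_simp
        ring
      have h' : k + 1 ≤ j := h
      simp [-one_div, hk0, h.not_gt, h.ne, h, hj, hk', h', hk, h.le, hj.symm]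
      nlinarith
    · have hp : 1 / (tipTime k : ℝ) * tipTime k = 1 := one_div_mul_cancel (by positivity)
      have hp0 : 0 ≤ 1 / (tipTime k : ℝ) := by positivity
      have hT : ((2 * ((k : ℝ) + 1)) ^ k) = tipTime k := by simp [tipTime]
      simp [-one_div, hk0, hk', hk, hT, hk0.symm]
      nlinarith
  · have h1 : tipBound i s = tipTime i + returnBound s := by simp [tipBound, h]
    have h2 := returnBound_drift hs
    obtain ⟨hp0, hp1⟩ := moveProb_mem s
    have h3 := mul_le_mul_of_nonneg_left (tipBound_le i (moveTo s)) hp0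
    have h4 := mul_le_mul_of_nonneg_left (tipBound_le i (fallTo s)) (sub_nonneg.2 hp1)
    have h5 : (0 : ℝ) ≤ if s = (i, i) then 2 else 0 := by split_ifs <;> norm_num
    rw [h1]
    nlinarith

/-- Start of the period during which the adversary uses ray `i`. -/
def periodStart : ℕ → ℕ
  | 0 => 0
  | i + 1 => periodStart i + (2 * (tipTime i + periodStart i * (1 + tipTime i)) + 1)

/-- The ray used by the adversary at time `n`. -/
def rayAt (n : ℕ) : ℕ := Nat.findGreatest (fun i => periodStart i ≤ n) n

theorem periodStart_strictMono : StrictMono periodStart :=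
  strictMono_nat_of_lt_succ fun i => by rw [periodStart]; omega

theorem periodStart_rayAt_le (n : ℕ) : periodStart (rayAt n) ≤ n :=
  Nat.findGreatest_spec (P := fun i => periodStart i ≤ n) (Nat.zero_le n) (Nat.zero_le n)

theorem rayAt_le {i n : ℕ} (h : n < periodStart (i + 1)) : rayAt n ≤ i :=
  Nat.lt_succ_iff.1 (periodStart_strictMono.lt_iff_lt.1 ((periodStart_rayAt_le n).trans_lt h))

theorem rayAt_eq {i n : ℕ} (h : periodStart i ≤ n) (h' : n < periodStart (i + 1)) :
    rayAt n = i :=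
  le_antisymm (rayAt_le h')
    (Nat.le_findGreatest ((periodStart_strictMono.le_apply).trans h) h)

theorem symm_ne_origin {X : Type} (e : ℕ × ℕ ≃ X) {x : X} (hx : x ≠ e (0, 0)) : e.symm x ≠ (0, 0) :=
  fun h => hx (by rw [← h, e.apply_symm_apply])

theorem tvDist_self {X : Type*} [MeasurableSpace X] (μ : Measure X) : tvDist μ μ = 0 := by
  simp [tvDist]

theorem tvDist_dirac_le {X : Type*} [MeasurableSpace X] [MeasurableSingletonClass X]
    (μ : Measure X) [IsProbabilityMeasure μ] (x : X) :
    tvDist μ (Measure.dirac x) ≤ μ {x}ᶜ := by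
  refine iSup_le fun A => ?_
  by_cases hx : x ∈ A.1
  · have h1 : (Measure.dirac x) A.1 = 1 := by simp [hx]
    rw [h1, tsub_eq_zero_of_le prob_le_one, ← prob_compl_eq_one_sub A.2, max_eq_right zero_le]
    exact measure_mono (compl_subset_compl.2 (by simpa using hx))
  · have h1 : (Measure.dirac x) A.1 = 0 := by simp [hx]
    rw [h1, tsub_zero, zero_tsub, max_eq_left zero_le]
    exact measure_mono (by simpa [subset_compl_singleton_iff] using hx)

section Chain

variable {X : Type} [MeasurableSpace X] [DiscreteMeasurableSpace X]

/-- The chain that moves outwards along its ray (or waits at the tip) with probability `moveProb`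
and falls back towards the origin along the axis otherwise. The origin is absorbing. -/
noncomputable def rayKernel (e : ℕ × ℕ ≃ X) : Kernel X X where
  toFun x := ENNReal.ofReal (moveProb (e.symm x)) • Measure.dirac (e (moveTo (e.symm x))) +
    ENNReal.ofReal (1 - moveProb (e.symm x)) • Measure.dirac (e (fallTo (e.symm x)))
  measurable' := Measurable.of_discrete

open Classical in
/-- `rayKernel` modified at the origin, which sends the chain to the start of ray `i`. -/
noncomputable def adversaryKernel (e : ℕ × ℕ ≃ X) (i : ℕ) : Kernel X X where
  toFun x := if x = e (0, 0) then Measure.dirac (e (1, i)) else rayKernel e x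
  measurable' := Measurable.of_discrete

theorem rayKernel_apply (e : ℕ × ℕ ≃ X) (x : X) :
    rayKernel e x =
      ENNReal.ofReal (moveProb (e.symm x)) • Measure.dirac (e (moveTo (e.symm x))) +
      ENNReal.ofReal (1 - moveProb (e.symm x)) • Measure.dirac (e (fallTo (e.symm x))) := rfl

theorem adversaryKernel_origin (e : ℕ × ℕ ≃ X) (i : ℕ) :
    adversaryKernel e i (e (0, 0)) = Measure.dirac (e (1, i)) := if_pos rfl

theorem adversaryKernel_of_ne (e : ℕ × ℕ ≃ X) (i : ℕ) {x : X} (hx : x ≠ e (0, 0)) :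
    adversaryKernel e i x = rayKernel e x := if_neg hx

theorem rayKernel_axis (e : ℕ × ℕ ≃ X) (k : ℕ) :
    rayKernel e (e (k, 0)) = Measure.dirac (e (k - 1, 0)) := by
  simp [rayKernel_apply, moveProb_axis, fallTo]

instance (e : ℕ × ℕ ≃ X) : IsMarkovKernel (rayKernel e) := ⟨fun x => ⟨by
  obtain ⟨h0, h1⟩ := moveProb_mem (e.symm x)
  simp only [rayKernel_apply, Measure.add_apply, Measure.smul_apply, measure_univ, smul_eq_mul,
    mul_one]
  rw [← ENNReal.ofReal_add h0 (by linarith)]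
  simp⟩⟩

instance (e : ℕ × ℕ ≃ X) (i : ℕ) : IsMarkovKernel (adversaryKernel e i) := ⟨fun x => by
  by_cases h : x = e (0, 0)
  · rw [h, adversaryKernel_origin]; infer_instance
  · rw [adversaryKernel_of_ne e i h]; infer_instance⟩

theorem lintegral_rayKernel (e : ℕ × ℕ ≃ X) {f : ℕ × ℕ → ℝ} (hf : ∀ s, 0 ≤ f s) (x : X) :
    ∫⁻ y, ENNReal.ofReal (f (e.symm y)) ∂rayKernel e x =
      ENNReal.ofReal (moveProb (e.symm x) * f (moveTo (e.symm x)) +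
        (1 - moveProb (e.symm x)) * f (fallTo (e.symm x))) := by
  obtain ⟨h0, h1⟩ := moveProb_mem (e.symm x)
  have h1 := sub_nonneg.2 h1
  rw [rayKernel_apply, lintegral_add_measure, lintegral_smul_measure, lintegral_smul_measure,
    lintegral_dirac, lintegral_dirac, ENNReal.ofReal_add (mul_nonneg h0 (hf _))
    (mul_nonneg h1 (hf _)), ENNReal.ofReal_mul h0, ENNReal.ofReal_mul h1]
  simp

theorem ofReal_add_one_le {a b : ℝ} (ha : 0 ≤ a) (h : a + 1 ≤ b) :
    ENNReal.ofReal a + 1 ≤ ENNReal.ofReal b := by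
  rw [← ENNReal.ofReal_one, ← ENNReal.ofReal_add ha zero_le_one]
  exact ENNReal.ofReal_le_ofReal h

theorem step_nonneg {f : ℕ × ℕ → ℝ} (hf : ∀ s, 0 ≤ f s) (s : ℕ × ℕ) :
    0 ≤ moveProb s * f (moveTo s) + (1 - moveProb s) * f (fallTo s) :=
  add_nonneg (mul_nonneg (moveProb_mem s).1 (hf _))
    (mul_nonneg (sub_nonneg.2 (moveProb_mem s).2) (hf _))

theorem lintegral_returnBound_add_one_le (e : ℕ × ℕ ≃ X) {x : X} (hx : x ≠ e (0, 0)) :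
    ∫⁻ y, ENNReal.ofReal (returnBound (e.symm y)) ∂rayKernel e x + 1 ≤
      ENNReal.ofReal (returnBound (e.symm x)) := by
  rw [lintegral_rayKernel e returnBound_nonneg]
  exact ofReal_add_one_le (step_nonneg returnBound_nonneg _)
    (returnBound_drift (symm_ne_origin e hx))

theorem lintegral_returnBound_adversary_le (e : ℕ × ℕ ≃ X) (i : ℕ) (x : X) :
    ∫⁻ y, ENNReal.ofReal (returnBound (e.symm y)) ∂adversaryKernel e i x ≤
      ENNReal.ofReal (returnBound (e.symm x)) + ENNReal.ofReal (1 + tipTime i) := by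
  by_cases hx : x = e (0, 0)
  · rw [hx, adversaryKernel_origin, lintegral_dirac]
    refine le_add_of_nonneg_of_le zero_le (ENNReal.ofReal_le_ofReal ?_)
    simp only [Equiv.symm_apply_apply, returnBound]
    split_ifs <;> simp
  · rw [adversaryKernel_of_ne e i hx]
    exact le_add_right (le_self_add.trans (lintegral_returnBound_add_one_le e hx))

theorem lintegral_tipBound_adversary_le (e : ℕ × ℕ ≃ X) {i : ℕ} (hi : i ≠ 0) (x : X) :
    ∫⁻ y, ENNReal.ofReal (tipBound i (e.symm y)) ∂adversaryKernel e i x + 1 ≤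
      ENNReal.ofReal (tipBound i (e.symm x)) + ({e (i, i)} : Set X).indicator (fun _ => 2) x := by
  by_cases hx : x = e (0, 0)
  · rw [hx, adversaryKernel_origin, lintegral_dirac]
    refine le_add_right ?_
    simp only [Equiv.symm_apply_apply]
    exact ofReal_add_one_le (tipBound_nonneg _ _) (tipBound_start hi)
  · rw [adversaryKernel_of_ne e i hx, lintegral_rayKernel e (tipBound_nonneg i)]
    refine (ofReal_add_one_le (step_nonneg (tipBound_nonneg i) _)
      (tipBound_drift (i := i) (symm_ne_origin e hx))).trans ?_
    have hxi : e.symm x = (i, i) ↔ x = e (i, i) := e.symm_apply_eq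
    refine ENNReal.ofReal_add_le.trans (add_le_add_right ?_ _)
    by_cases h : x = e (i, i)
    · simp [h]
    · simp [hxi, h]

variable {ν : ℕ → Measure X} {e : ℕ × ℕ ≃ X}

theorem lintegral_returnBound_law_le (h0 : ν 0 = Measure.dirac (e (0, 0)))
    [∀ n, IsProbabilityMeasure (ν n)]
    (hν : ∀ n, ν (n + 1) = (ν n).bind (adversaryKernel e (rayAt n))) {i n : ℕ}
    (hn : n ≤ periodStart (i + 1)) :
    ∫⁻ y, ENNReal.ofReal (returnBound (e.symm y)) ∂ν n ≤ ENNReal.ofReal (n * (1 + tipTime i)) := by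
  induction n with
  | zero => simp [h0, lintegral_dirac, returnBound]
  | succ n ih =>
    rw [hν, Measure.lintegral_bind (Kernel.measurable _).aemeasurable
      Measurable.of_discrete.aemeasurable]
    refine (lintegral_mono fun x => lintegral_returnBound_adversary_le e (rayAt n) x).trans ?_
    rw [lintegral_add_right _ measurable_const, lintegral_const, measure_univ, mul_one]
    refine (add_le_add (ih (by omega)) (ENNReal.ofReal_le_ofReal
      (q := (1 + tipTime i : ℝ)) ?_)).trans ?_
    · have : (tipTime (rayAt n) : ℝ) ≤ tipTime i := by
        exact_mod_cast tipTime_mono (rayAt_le (by omega))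
      linarith
    · rw [← ENNReal.ofReal_add (by positivity) (by positivity)]
      refine ENNReal.ofReal_le_ofReal (le_of_eq ?_)
      push_cast; ring

theorem exists_law_tip_gt (h0 : ν 0 = Measure.dirac (e (0, 0)))
    [∀ n, IsProbabilityMeasure (ν n)]
    (hν : ∀ n, ν (n + 1) = (ν n).bind (adversaryKernel e (rayAt n))) {i : ℕ} (hi : i ≠ 0) :
    ∃ n, 1 / 4 < ν n {e (i, i)} := by
  by_contra! hcon
  set T : ℕ := tipTime i + periodStart i * (1 + tipTime i) with hT
  have hstep : periodStart (i + 1) = periodStart i + (2 * T + 1) := rfl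
  let m : ℕ → ℝ≥0∞ := fun n => ∫⁻ y, ENNReal.ofReal (tipBound i (e.symm y)) ∂ν n
  have hstart : m (periodStart i) ≤ T := by
    calc m (periodStart i) ≤ ∫⁻ y, ENNReal.ofReal (returnBound (e.symm y)) +
            ENNReal.ofReal (tipTime i) ∂ν (periodStart i) := by
          refine lintegral_mono fun y => ?_
          rw [← ENNReal.ofReal_add (returnBound_nonneg _) (by positivity), add_comm]
          exact ENNReal.ofReal_le_ofReal (tipBound_le i _)
      _ ≤ ENNReal.ofReal (periodStart i * (1 + tipTime i)) + ENNReal.ofReal (tipTime i) := by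
          rw [lintegral_add_right _ measurable_const, lintegral_const, measure_univ, mul_one]
          gcongr
          exact lintegral_returnBound_law_le h0 hν (periodStart_strictMono.monotone (Nat.le_succ i))
      _ = T := by
          rw [← ENNReal.ofReal_add (by positivity) (by positivity), ← ENNReal.ofReal_natCast, hT]
          congr 1
          push_cast; ring
  have hdrift : ∀ n, periodStart i ≤ n → n < periodStart (i + 1) → m (n + 1) + 1 ≤ m n + 1 / 2 := by
    intro n h h'
    have hr := rayAt_eq h h'
    calc m (n + 1) + 1 = ∫⁻ x, (∫⁻ y, ENNReal.ofReal (tipBound i (e.symm y))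
            ∂adversaryKernel e i x + 1) ∂ν n := by
          rw [lintegral_add_right _ measurable_const, lintegral_const, measure_univ, mul_one]
          simp only [m]
          rw [hν, hr, Measure.lintegral_bind (Kernel.measurable _).aemeasurable
            Measurable.of_discrete.aemeasurable]
      _ ≤ ∫⁻ x, ENNReal.ofReal (tipBound i (e.symm x)) +
            ({e (i, i)} : Set X).indicator (fun _ => 2) x ∂ν n :=
          lintegral_mono fun x => lintegral_tipBound_adversary_le e hi x
      _ = m n + 2 * ν n {e (i, i)} := by
          rw [lintegral_add_left Measurable.of_discrete,
            lintegral_indicator_const (MeasurableSet.of_discrete)]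
      _ ≤ m n + 2 * (1 / 4) := by gcongr; exact hcon n
      _ = m n + 1 / 2 := by
          congr 1
          rw [show (4 : ℝ≥0∞) = 2 * 2 by norm_num, one_div, one_div,
            ENNReal.mul_inv (by simp) (by simp), ← mul_assoc,
            ENNReal.mul_inv_cancel (by simp) (by simp), one_mul]
  have hdec : ∀ l, l ≤ 2 * T + 1 → 2 * m (periodStart i + l) + l ≤ 2 * T := by
    intro l
    induction l with
    | zero => intro _; simpa using mul_le_mul_right hstart 2
    | succ l ih =>
      intro hl
      have h1 := hdrift (periodStart i + l) (by omega) (by omega)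
      have h2 := mul_le_mul_right h1 2
      rw [mul_add, mul_add, one_div, ENNReal.mul_inv_cancel (by simp) (by simp), mul_one] at h2
      have h3 := ih (by omega)
      have h4 : 2 * m (periodStart i + l + 1) + 1 ≤ 2 * m (periodStart i + l) := by
        refine (ENNReal.add_le_add_iff_right (a := 1) (by simp)).1 ?_
        rw [add_assoc, one_add_one_eq_two]
        exact h2
      rw [← add_assoc]
      push_cast
      calc _ = 2 * m (periodStart i + l + 1) + 1 + l := by ring
        _ ≤ _ := (add_le_add_left h4 _).trans h3
  have h5 := le_add_self.trans (hdec (2 * T + 1) le_rfl)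
  have h6 : 2 * T + 1 ≤ 2 * T := by exact_mod_cast h5
  omega

instance isMarkovKernel_iterK (P : Kernel X X) [IsMarkovKernel P] (n : ℕ) :
    IsMarkovKernel (iterK P n) := by
  induction n with
  | zero => rw [iterK]; infer_instance
  | succ n ih => rw [iterK]; infer_instance

theorem harrisErgodic_rayKernel (e : ℕ × ℕ ≃ X) :
    HarrisErgodic (rayKernel e) (Measure.dirac (e (0, 0))) := by
  refine ⟨fun A _ => by rw [lintegral_dirac, rayKernel_axis], fun x => ?_⟩
  let m : ℕ → ℝ≥0∞ := fun n =>
    ∫⁻ y, ENNReal.ofReal (returnBound (e.symm y)) ∂iterK (rayKernel e) n x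
  let u : ℕ → ℝ≥0∞ := fun n => iterK (rayKernel e) n x {e (0, 0)}ᶜ
  have hstep : ∀ n, m (n + 1) + u n ≤ m n := by
    intro n
    calc m (n + 1) + u n = ∫⁻ z, (∫⁻ y, ENNReal.ofReal (returnBound (e.symm y)) ∂rayKernel e z +
          ({e (0, 0)}ᶜ : Set X).indicator (fun _ => 1) z) ∂iterK (rayKernel e) n x := by
          rw [lintegral_add_left Measurable.of_discrete,
            lintegral_indicator_const (MeasurableSet.of_discrete), one_mul]
          simp only [m, u]
          rw [iterK, Kernel.comp_apply, Measure.lintegral_bind (Kernel.measurable _).aemeasurable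
            Measurable.of_discrete.aemeasurable]
      _ ≤ m n := by
          refine lintegral_mono fun z => ?_
          by_cases hz : z = e (0, 0)
          · simp [hz, rayKernel_axis, lintegral_dirac, returnBound]
          · simpa [hz] using lintegral_returnBound_add_one_le e hz
  have hsum : ∀ n, m n + ∑ k ∈ Finset.range n, u k ≤ m 0 := by
    intro n
    induction n with
    | zero => simp
    | succ n ih =>
      rw [Finset.sum_range_succ, add_comm (∑ k ∈ _, _), ← add_assoc]
      exact (add_le_add_left (hstep n) _).trans ih
  have hm0 : m 0 ≠ ⊤ := by
    simp [m, iterK, Kernel.deterministic_apply, lintegral_dirac]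
  have hu : Tendsto u atTop (𝓝 0) := by
    refine ENNReal.tendsto_atTop_zero_of_tsum_ne_top (ne_top_of_le_ne_top hm0 ?_)
    rw [ENNReal.tsum_eq_iSup_nat]
    exact iSup_le fun n => le_add_self.trans (hsum n)
  exact tendsto_of_tendsto_of_tendsto_of_le_of_le tendsto_const_nhds hu (fun _ => zero_le)
    fun n => tvDist_dirac_le _ _

end Chain

/-- Embedding of the states into the plane: ray `i` lies at height `1 / i`, and the axis, `i = 0`,
at height `0`. -/
noncomputable def combPoint (s : ℕ × ℕ) : EuclideanSpace ℝ (Fin 2) := !₂[(s.1 : ℝ), (s.2 : ℝ)⁻¹]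

theorem combPoint_injective : Function.Injective combPoint := fun s t h => by
  have h0 := congrArg (fun x : EuclideanSpace ℝ (Fin 2) => x 0) h
  have h1 := congrArg (fun x : EuclideanSpace ℝ (Fin 2) => x 1) h
  simp [combPoint] at h0 h1
  exact Prod.ext h0 h1

theorem isClosed_range_combPoint : IsClosed (range combPoint) := by
  have h0 : IsClosed (range ((↑) : ℕ → ℝ)) := Nat.isClosedEmbedding_coe_real.isClosed_range
  have h1 : IsClosed (range fun i : ℕ => (i : ℝ)⁻¹) := by
    have h := (tendsto_inv_atTop_nhds_zero_nat (𝕜 := ℝ)).isCompact_insert_range.isClosed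
    rwa [insert_eq_of_mem (show (0 : ℝ) ∈ range fun i : ℕ => (i : ℝ)⁻¹ from ⟨0, by simp⟩)] at h
  have h : range combPoint = (fun x : EuclideanSpace ℝ (Fin 2) => x 0) ⁻¹' range ((↑) : ℕ → ℝ) ∩
      (fun x : EuclideanSpace ℝ (Fin 2) => x 1) ⁻¹' range fun i : ℕ => (i : ℝ)⁻¹ := by
    ext x
    constructor
    · rintro ⟨s, rfl⟩
      exact ⟨⟨s.1, by simp [combPoint]⟩, ⟨s.2, by simp [combPoint]⟩⟩
    · rintro ⟨⟨k, hk⟩, ⟨i, hi⟩⟩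
      refine ⟨(k, i), ?_⟩
      ext j
      fin_cases j
      · simpa [combPoint] using hk
      · simpa [combPoint] using hi
  rw [h]
  exact (h0.preimage (by fun_prop)).inter (h1.preimage (by fun_prop))

theorem dist_combPoint_le (s t : ℕ × ℕ) :
    dist (combPoint s) (combPoint t) ≤ |(s.1 : ℝ) - t.1| + |(s.2 : ℝ)⁻¹ - (t.2 : ℝ)⁻¹| := by
  rw [EuclideanSpace.dist_eq, Fin.sum_univ_two]
  refine Real.sqrt_le_iff.2 ⟨by positivity, ?_⟩
  simp only [combPoint, Real.dist_eq]
  simp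
  nlinarith [abs_nonneg ((s.1 : ℝ) - t.1), abs_nonneg ((s.2 : ℝ)⁻¹ - (t.2 : ℝ)⁻¹),
    sq_abs ((s.1 : ℝ) - t.1), sq_abs ((s.2 : ℝ)⁻¹ - (t.2 : ℝ)⁻¹)]

theorem abs_fst_sub_le_dist (s t : ℕ × ℕ) :
    |(s.1 : ℝ) - t.1| ≤ dist (combPoint s) (combPoint t) := by
  simpa [combPoint, dist_eq_norm] using PiLp.norm_apply_le (combPoint s - combPoint t) 0

theorem abs_inv_snd_sub_le_dist (s t : ℕ × ℕ) :
    |(s.2 : ℝ)⁻¹ - (t.2 : ℝ)⁻¹| ≤ dist (combPoint s) (combPoint t) := by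
  simpa [combPoint, dist_eq_norm] using PiLp.norm_apply_le (combPoint s - combPoint t) 1

theorem abs_inv_natCast_sub_le (i j : ℕ) : |(i : ℝ)⁻¹ - (j : ℝ)⁻¹| ≤ 1 := by
  have := Nat.cast_inv_le_one (α := ℝ) i
  have := Nat.cast_inv_le_one (α := ℝ) j
  have : (0 : ℝ) ≤ (i : ℝ)⁻¹ := by positivity
  have : (0 : ℝ) ≤ (j : ℝ)⁻¹ := by positivity
  rw [abs_le]
  constructor <;> linarith

theorem dist_combPoint_moveTo (s : ℕ × ℕ) : dist (combPoint s) (combPoint (moveTo s)) ≤ 2 := by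
  unfold moveTo
  split_ifs
  · refine (dist_combPoint_le _ _).trans ?_
    simp
  · simp

theorem dist_combPoint_fallTo (s : ℕ × ℕ) : dist (combPoint s) (combPoint (fallTo s)) ≤ 2 := by
  refine (dist_combPoint_le _ _).trans ?_
  have h1 := abs_inv_natCast_sub_le s.2 (fallTo s).2
  have h2 : |(s.1 : ℝ) - (fallTo s).1| ≤ 1 := by
    rcases Nat.eq_zero_or_pos s.1 with h | h
    · simp [fallTo, h]
    · simp [fallTo, Nat.cast_sub h]
  linarith

theorem fst_eq_of_dist_lt_one {s t : ℕ × ℕ} (h : dist (combPoint s) (combPoint t) < 1) :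
    s.1 = t.1 := by
  have := (abs_fst_sub_le_dist s t).trans_lt h
  have h' : |((s.1 : ℤ) - t.1)| < 1 := by exact_mod_cast this
  have := Int.abs_lt_one_iff.1 h'
  omega

theorem exists_dist_lt_imp_eq {s : ℕ × ℕ} (hs : s.2 ≠ 0) :
    ∃ δ : ℝ, 0 < δ ∧ ∀ t, dist (combPoint s) (combPoint t) < δ → t = s := by
  have hc : ContinuousAt (fun z : ℝ => z⁻¹) (s.2 : ℝ)⁻¹ :=
    continuousAt_inv₀ (inv_ne_zero (Nat.cast_ne_zero.2 hs))
  obtain ⟨δ, hδ, h⟩ := Metric.continuousAt_iff.1 hc 1 one_pos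
  refine ⟨min δ 1, lt_min hδ one_pos, fun t ht => Prod.ext ?_ ?_⟩
  · exact (fst_eq_of_dist_lt_one (ht.trans_le (min_le_right _ _))).symm
  · have h1 : dist (t.2 : ℝ)⁻¹ (s.2 : ℝ)⁻¹ < δ := by
      rw [dist_comm, Real.dist_eq]
      exact (abs_inv_snd_sub_le_dist s t).trans_lt (ht.trans_le (min_le_left _ _))
    have h2 := h h1
    rw [inv_inv, inv_inv, Real.dist_eq] at h2
    have h' : |((t.2 : ℤ) - s.2)| < 1 := by exact_mod_cast h2
    have := Int.abs_lt_one_iff.1 h'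
    omega

noncomputable def combEquiv : ℕ × ℕ ≃ range combPoint := Equiv.ofInjective _ combPoint_injective

theorem dist_combEquiv (s t : ℕ × ℕ) :
    dist (combEquiv s) (combEquiv t) = dist (combPoint s) (combPoint t) := rfl

instance : Countable (range combPoint) := (countable_range combPoint).to_subtype

theorem rayKernel_bounded_jumps (x : range combPoint) :
    rayKernel combEquiv x {y | dist x y ≤ 2} = 1 := by
  obtain ⟨s, rfl⟩ := combEquiv.surjective x
  obtain ⟨h0, h1⟩ := moveProb_mem s
  simp only [rayKernel_apply, Measure.add_apply, Measure.smul_apply, smul_eq_mul,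
    Equiv.symm_apply_apply, Measure.dirac_apply, indicator, mem_ofPred_eq, dist_combEquiv,
    dist_combPoint_moveTo, dist_combPoint_fallTo, if_true, Pi.one_apply, mul_one]
  rw [← ENNReal.ofReal_add h0 (by linarith)]
  simp

theorem rayKernel_tvDist_continuous (x : range combPoint) {ε : ℝ} (hε : 0 < ε) :
    ∃ δ : ℝ, 0 < δ ∧ ∀ y, dist x y < δ →
      tvDist (rayKernel combEquiv y) (rayKernel combEquiv x) < ENNReal.ofReal ε := by
  obtain ⟨⟨k, i⟩, rfl⟩ := combEquiv.surjective x
  by_cases hi : i = 0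
  · subst hi
    refine ⟨min ε (1 / (k + 1)), by positivity, fun y hy => ?_⟩
    obtain ⟨⟨l, j⟩, rfl⟩ := combEquiv.surjective y
    rw [dist_combEquiv] at hy
    have hk1 : (1 : ℝ) / (k + 1) ≤ 1 := by
      rw [div_le_one (by positivity)]; linarith [(Nat.cast_nonneg k : (0 : ℝ) ≤ k)]
    obtain rfl : k = l :=
      fst_eq_of_dist_lt_one (hy.trans_le ((min_le_right _ _).trans hk1))
    by_cases hj : j = 0
    · rw [hj, tvDist_self]; simpa using hε
    have hj0 : (0 : ℝ) < j := by positivity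
    have hjd : (j : ℝ)⁻¹ < min ε (1 / (k + 1)) := by
      simpa using (abs_inv_snd_sub_le_dist (k, 0) (k, j)).trans_lt hy
    have hkj : k < j := by
      have h := hjd.trans_le (min_le_right _ _)
      rw [← one_div, one_div_lt_one_div hj0 (by positivity)] at h
      have h : k + 1 < j := by exact_mod_cast h
      omega
    have hp : moveProb (k, j) < ε :=
      calc moveProb (k, j) ≤ 1 / ((j : ℝ) + 1) := moveProb_le hkj
        _ ≤ 1 / j := one_div_le_one_div_of_le hj0 (by linarith)
        _ < ε := by rw [one_div]; exact hjd.trans_le (min_le_left _ _)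
    rw [rayKernel_axis]
    refine (tvDist_dirac_le _ _).trans_lt
      (lt_of_le_of_lt ?_ ((ENNReal.ofReal_lt_ofReal_iff hε).2 hp))
    simp only [rayKernel_apply, Measure.add_apply, Measure.smul_apply, smul_eq_mul,
      Equiv.symm_apply_apply]
    have hf : (Measure.dirac (combEquiv (fallTo (k, j)))) {combEquiv (k - 1, 0)}ᶜ = 0 := by
      simp [fallTo]
    rw [hf, mul_zero, add_zero]
    exact mul_le_of_le_one_right zero_le prob_le_one
  · obtain ⟨δ, hδ, h⟩ := exists_dist_lt_imp_eq (s := (k, i)) hi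
    refine ⟨δ, hδ, fun y hy => ?_⟩
    obtain ⟨t, rfl⟩ := combEquiv.surjective y
    rw [h t hy, tvDist_self]
    simpa using hε

/-- Proposition 3 (counterexprop): there is a countable closed subset 𝒳 of ℝ², a Harris
ergodic Markov kernel P on 𝒳 with bounded jumps satisfying the strong continuity
condition, a bounded nonempty K ⊆ 𝒳, and an adversarial process which is NOT bounded in
probability. -/
theorem exists_adversarial_counterexample :
    ∃ 𝒳 : Set (EuclideanSpace ℝ (Fin 2)), 𝒳.Countable ∧ IsClosed 𝒳 ∧
    ∃ o : 𝒳, ∃ P : Kernel 𝒳 𝒳, IsMarkovKernel P ∧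
    ∃ π : Measure 𝒳, IsProbabilityMeasure π ∧ HarrisErgodic P π ∧
    ∃ D : ℝ, 0 < D ∧ (∀ x : 𝒳, P x {y : 𝒳 | dist x y ≤ D} = 1) ∧
    -- strong continuity condition (6)
    (∀ x : 𝒳, ∀ ε : ℝ, 0 < ε → ∃ δ : ℝ, 0 < δ ∧
      ∀ y : 𝒳, dist x y < δ → tvDist (P y) (P x) < ENNReal.ofReal ε) ∧
    ∃ K : Set 𝒳, MeasurableSet K ∧ K.Nonempty ∧ Bornology.IsBounded K ∧
    ∃ x₀ : 𝒳, x₀ ∈ K ∧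
    ∃ (Ω : Type) (_ : MeasurableSpace Ω) (μ : Measure Ω), IsProbabilityMeasure μ ∧
    ∃ Xp : ℕ → Ω → 𝒳, IsAdversarial P K D x₀ μ Xp ∧ ¬ BoundedInProb μ Xp o := by
  refine ⟨range combPoint, countable_range _, isClosed_range_combPoint, combEquiv (0, 0),
    rayKernel combEquiv, inferInstance, Measure.dirac (combEquiv (0, 0)), inferInstance,
    harrisErgodic_rayKernel _, 2, two_pos, rayKernel_bounded_jumps,
    fun x ε hε => rayKernel_tvDist_continuous x hε, {combEquiv (0, 0)}, measurableSet_singleton _,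
    singleton_nonempty _, Bornology.isBounded_singleton, combEquiv (0, 0), rfl, ?_⟩
  obtain ⟨μ, Y, hμ, hYm, hY0, hY⟩ :=
    exists_markov_chain (fun n => adversaryKernel combEquiv (rayAt n)) (combEquiv (0, 0))
  have hYc : ∀ n, Measurable[MeasurableSpace.comap
      (fun ω (i : Fin (n + 1)) => Y i ω) inferInstance] (Y n) := fun n =>
    (measurable_pi_apply (Fin.last n)).comp
      (comap_measurable fun ω (i : Fin (n + 1)) => Y i ω)
  refine ⟨ℕ → range combPoint, inferInstance, μ, hμ, Y, ⟨hYm, hY0, ?_, ?_⟩, ?_⟩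
  · intro n A hA E hE
    have hK : MeasurableSet[MeasurableSpace.comap (fun ω (i : Fin (n + 1)) => Y i ω)
        inferInstance] {ω | Y n ω ∉ ({combEquiv (0, 0)} : Set (range combPoint))} :=
      hYc n (measurableSet_singleton (combEquiv (0, 0))).compl
    have hle : MeasurableSpace.comap (fun ω (i : Fin (n + 1)) => Y i ω) inferInstance ≤
        (inferInstance : MeasurableSpace (ℕ → range combPoint)) :=
      (measurable_pi_lambda (fun ω (i : Fin (n + 1)) => Y i ω) fun i => hYm i).comap_le
    rw [hY n A hA _ (hE.inter hK)]
    refine setLIntegral_congr_fun (hle _ (hE.inter hK)) fun ω hω => ?_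
    rw [adversaryKernel_of_ne _ _ hω.2]
  · intro n
    have hK := hYc n (measurableSet_singleton (combEquiv (0, 0)))
    refine (hY n (cthickening 2 {combEquiv (0, 0)})ᶜ isClosed_cthickening.measurableSet.compl _
      hK).trans ?_
    refine (setLIntegral_congr_fun (g := 0) (hYm n (measurableSet_singleton _))
      fun ω hω => ?_).trans (by simp)
    have hω : Y n ω = combEquiv (0, 0) := hω
    have hd : dist (combEquiv (1, rayAt n)) (combEquiv (0, 0)) ≤ 2 := by
      rw [dist_combEquiv]
      refine (dist_combPoint_le _ _).trans ?_
      have := abs_inv_natCast_sub_le (rayAt n) 0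
      norm_num at this ⊢
      linarith
    simp only [hω, adversaryKernel_origin]
    simpa using hd
  · intro hb
    have : ∀ n, IsProbabilityMeasure (μ.map (Y n)) := fun n =>
      Measure.isProbabilityMeasure_map (hYm n).aemeasurable
    have h0 : μ.map (Y 0) = Measure.dirac (combEquiv (0, 0)) := by
      rw [show Y 0 = fun _ => combEquiv (0, 0) from funext hY0]
      simp
    have hν : ∀ n, μ.map (Y (n + 1)) =
        (μ.map (Y n)).bind (adversaryKernel combEquiv (rayAt n)) := by
      intro n
      ext A hA
      rw [Measure.map_apply (hYm _) hA, Measure.bind_apply hA (Kernel.measurable _).aemeasurable,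
        lintegral_map (Kernel.measurable_coe _ hA) (hYm n)]
      simpa using! hY n A hA univ MeasurableSet.univ
    obtain ⟨L, hL⟩ := ((hb.eventually_lt_const (u := (1 / 4 : ℝ≥0∞)) (by simp)).and
      (eventually_ge_atTop 0)).exists
    obtain ⟨i, hi⟩ := exists_nat_gt L
    have hi0 : i ≠ 0 := by
      rintro rfl
      exact absurd hL.2 (by simpa using hi)
    obtain ⟨n, hn⟩ := exists_law_tip_gt (ν := fun n => μ.map (Y n)) h0 hν hi0
    rw [Measure.map_apply (hYm n) (measurableSet_singleton _)] at hn
    refine absurd (hn.trans_le ((measure_mono fun ω hω => ?_).trans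
      (le_iSup (fun n => μ {ω | L < dist (Y n ω) (combEquiv (0, 0))}) n))) hL.1.not_gt
    have hω : Y n ω = combEquiv (i, i) := hω
    have hd := abs_fst_sub_le_dist (i, i) (0, 0)
    simp only [Nat.cast_zero, sub_zero, Nat.abs_cast] at hd
    rw [mem_ofPred_eq, hω, dist_combEquiv]
    exact hi.trans_le hd
end

section
/- In the adversarial setup, suppose assumptions (A4) (geometric ergodicity of P) and (A5) hold. Then every adversarial process {X_n} is bounded in probability: lim_{L→∞} sup_n ℙ(η(X_n,𝟎) > L | X_0 = x_0) = 0. -/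
open MeasureTheory ProbabilityTheory Filter Metric Set
open scoped ENNReal Topology

section AvoidingExpectation

variable {X : Type*} [MeasurableSpace X] {P : Kernel X X} {π : Measure X}

/-- `avoid P C g n x` is the expectation of `g (Yₙ)` on the event `Y₀, …, Yₙ₋₁ ∉ C`, for the Markov
chain `Y` with kernel `P` started at `x`. -/
noncomputable def avoid (P : Kernel X X) (C : Set X) (g : X → ℝ≥0∞) : ℕ → X → ℝ≥0∞
  | 0 => g
  | n + 1 => Cᶜ.indicator fun x => ∫⁻ y, avoid P C g n y ∂(P x)

lemma measurable_avoid {C : Set X} (hC : MeasurableSet C) {g : X → ℝ≥0∞} (hg : Measurable g)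
    (n : ℕ) : Measurable (avoid P C g n) := by
  induction n with
  | zero => exact hg
  | succ n ih => exact ih.lintegral_kernel.indicator hC.compl

lemma avoid_mono {C C' : Set X} (hC : C' ⊆ C) {g g' : X → ℝ≥0∞} (hg : g ≤ g') (n : ℕ) :
    avoid P C g n ≤ avoid P C' g' n := by
  induction n with
  | zero => exact hg
  | succ n ih =>
    intro x
    simp only [avoid]
    exact (indicator_le_indicator_of_subset (compl_subset_compl.2 hC) (fun _ => zero_le) x).trans
      (indicator_le_indicator (lintegral_mono ih))

lemma lintegral_lintegral_of_invariant
    (hinv : ∀ A : Set X, MeasurableSet A → ∫⁻ x, P x A ∂π = π A)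
    {g : X → ℝ≥0∞} (hg : Measurable g) : ∫⁻ x, ∫⁻ y, g y ∂(P x) ∂π = ∫⁻ x, g x ∂π := by
  have hbind : π.bind P = π := by
    ext A hA
    rw [Measure.bind_apply hA P.aemeasurable, hinv A hA]
  rw [← Measure.lintegral_bind P.aemeasurable hg.aemeasurable, hbind]

lemma lintegral_avoid_le (hinv : ∀ A : Set X, MeasurableSet A → ∫⁻ x, P x A ∂π = π A)
    {C : Set X} (hC : MeasurableSet C) {g : X → ℝ≥0∞} (hg : Measurable g) (n : ℕ) :
    ∫⁻ x, avoid P C g n x ∂π ≤ ∫⁻ x, g x ∂π := by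
  induction n with
  | zero => exact le_rfl
  | succ n ih =>
    calc ∫⁻ x, avoid P C g (n + 1) x ∂π
        ≤ ∫⁻ x, ∫⁻ y, avoid P C g n y ∂(P x) ∂π :=
          lintegral_mono fun x => indicator_le_self _ _ x
      _ = ∫⁻ x, avoid P C g n x ∂π :=
          lintegral_lintegral_of_invariant hinv (measurable_avoid hC hg n)
      _ ≤ _ := ih

lemma iterK_succ (P : Kernel X X) (n : ℕ) : iterK P (n + 1) = (iterK P n).comp P := by
  induction n with
  | zero =>
    simp only [iterK]
    exact (Kernel.comp_id P).trans (Kernel.id_comp P).symm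
  | succ n ih =>
    change P.comp (iterK P (n + 1)) = (P.comp (iterK P n)).comp P
    rw [ih, Kernel.comp_assoc]

lemma iterK_succ_apply (P : Kernel X X) (n : ℕ) (x : X) {A : Set X} (hA : MeasurableSet A) :
    iterK P (n + 1) x A = ∫⁻ y, iterK P n y A ∂(P x) := by
  rw [iterK_succ, Kernel.comp_apply' _ _ _ hA]

lemma lintegral_iterK (hinv : ∀ A : Set X, MeasurableSet A → ∫⁻ x, P x A ∂π = π A)
    {A : Set X} (hA : MeasurableSet A) (n : ℕ) : ∫⁻ x, iterK P n x A ∂π = π A := by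
  induction n with
  | zero =>
    simp only [iterK, Kernel.deterministic_apply' _ _ hA, id]
    exact lintegral_indicator_one hA
  | succ n ih =>
    simp_rw [iterK_succ_apply P n _ hA]
    rw [lintegral_lintegral_of_invariant hinv (Kernel.measurable_coe _ hA), ih]

lemma measure_le_add_tvDist (μ ν : Measure X) {A : Set X} (hA : MeasurableSet A) :
    μ A ≤ ν A + tvDist μ ν := by
  rw [← tsub_le_iff_left]
  exact le_sup_left.trans
    (le_iSup (fun A : {s : Set X // MeasurableSet s} => (μ A.1 - ν A.1) ⊔ (ν A.1 - μ A.1)) ⟨A, hA⟩)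

/-- If the expected occupation times of `A` exceed their stationary values by at most `b` when the
chain starts in `A`, then the expected time spent before hitting `A` makes up for the difference
from any starting point. -/
lemma sum_iterK_add_sum_avoid_le [IsMarkovKernel P] {A : Set X} (hA : MeasurableSet A) {a b : ℝ≥0∞}
    (hb : ∀ N : ℕ, ∀ x ∈ A, ∑ n ∈ Finset.range N, iterK P n x A ≤ N * a + b) (N : ℕ) (x : X) :
    ∑ n ∈ Finset.range N, iterK P n x A
      + a * ∑ n ∈ Finset.range N, avoid P A (Aᶜ.indicator 1) n x ≤ N * a + b := by
  induction N generalizing x with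
  | zero => simp
  | succ N ih =>
    have hmeas := measurable_avoid (P := P) hA
      ((measurable_one (α := ℝ≥0∞)).indicator hA.compl)
    by_cases hx : x ∈ A
    · have h0 : ∀ n, avoid P A (Aᶜ.indicator 1) n x = 0 := by
        intro n
        cases n <;> simp [avoid, hx]
      simpa [h0] using hb (N + 1) x hx
    · have hiter : ∑ n ∈ Finset.range (N + 1), iterK P n x A
          = ∫⁻ y, ∑ n ∈ Finset.range N, iterK P n y A ∂(P x) := by
        rw [Finset.sum_range_succ', lintegral_finsetSum _ fun n _ => Kernel.measurable_coe _ hA]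
        simp_rw [iterK_succ_apply P _ _ hA]
        simp [iterK, Kernel.deterministic_apply' _ _ hA, hx]
      have havoid : ∑ n ∈ Finset.range (N + 1), avoid P A (Aᶜ.indicator 1) n x
          = (∫⁻ y, ∑ n ∈ Finset.range N, avoid P A (Aᶜ.indicator 1) n y ∂(P x)) + 1 := by
        rw [Finset.sum_range_succ', lintegral_finsetSum _ fun n _ => hmeas n]
        simp [avoid, hx]
      calc _ = (∫⁻ y, (∑ n ∈ Finset.range N, iterK P n y A
              + a * ∑ n ∈ Finset.range N, avoid P A (Aᶜ.indicator 1) n y) ∂(P x)) + a := by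
            rw [hiter, havoid, mul_add, mul_one, ← add_assoc,
              lintegral_add_left (Finset.measurable_fun_sum _ fun n _ => Kernel.measurable_coe _ hA),
              lintegral_const_mul _ (Finset.measurable_fun_sum _ fun n _ => hmeas n)]
        _ ≤ (∫⁻ _, (N * a + b) ∂(P x)) + a := add_le_add_left (lintegral_mono ih) a
        _ = ((N + 1 : ℕ) : ℝ≥0∞) * a + b := by simp; ring

lemma tsum_lintegral_avoid_ne_top [IsMarkovKernel P] [IsProbabilityMeasure π]
    (hinv : ∀ A : Set X, MeasurableSet A → ∫⁻ x, P x A ∂π = π A)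
    {A : Set X} (hA : MeasurableSet A) (hπA : π A ≠ 0) {R ρ : ℝ≥0∞} (hR : R ≠ ⊤) (hρ : ρ < 1)
    (htv : ∀ n, ∀ x ∈ A, tvDist (iterK P n x) π ≤ R * ρ ^ n) :
    ∑' n, ∫⁻ x, avoid P A (Aᶜ.indicator 1) n x ∂π ≠ ⊤ := by
  set b : ℝ≥0∞ := R * (1 - ρ)⁻¹ with hbdef
  have hb_top : b ≠ ⊤ :=
    ENNReal.mul_ne_top hR (ENNReal.inv_ne_top.2 (tsub_pos_of_lt hρ).ne')
  have hb : ∀ N : ℕ, ∀ x ∈ A, ∑ n ∈ Finset.range N, iterK P n x A ≤ N * π A + b := by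
    intro N x hx
    calc ∑ n ∈ Finset.range N, iterK P n x A
        ≤ ∑ n ∈ Finset.range N, (π A + R * ρ ^ n) :=
          Finset.sum_le_sum fun n _ => (measure_le_add_tvDist _ π hA).trans
            (by gcongr; exact htv n x hx)
      _ = N * π A + R * ∑ n ∈ Finset.range N, ρ ^ n := by
          simp [Finset.sum_add_distrib, Finset.mul_sum]
      _ ≤ N * π A + b := by
          rw [hbdef, ← ENNReal.tsum_geometric]
          gcongr
          exact ENNReal.sum_le_tsum _
  have hmeas := measurable_avoid (P := P) hA
    ((measurable_one (α := ℝ≥0∞)).indicator hA.compl)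
  have hbound : ∀ N : ℕ,
      π A * ∑ n ∈ Finset.range N, ∫⁻ x, avoid P A (Aᶜ.indicator 1) n x ∂π ≤ b := by
    intro N
    have h := lintegral_mono (μ := π) (sum_iterK_add_sum_avoid_le hA hb N)
    rw [lintegral_add_left (Finset.measurable_fun_sum _ fun n _ => Kernel.measurable_coe _ hA),
      lintegral_const_mul _ (Finset.measurable_fun_sum _ fun n _ => hmeas n),
      lintegral_finsetSum _ fun n _ => Kernel.measurable_coe _ hA,
      lintegral_finsetSum _ fun n _ => hmeas n] at h
    simp only [lintegral_iterK hinv hA, Finset.sum_const, Finset.card_range, nsmul_eq_mul,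
      lintegral_const, measure_univ, mul_one] at h
    exact (ENNReal.add_le_add_iff_left
      (ENNReal.mul_ne_top (ENNReal.natCast_ne_top N) (measure_ne_top π A))).1 h
  refine ne_top_of_le_ne_top (ENNReal.div_ne_top hb_top hπA) ?_
  rw [ENNReal.tsum_eq_iSup_nat]
  refine iSup_le fun N => ?_
  rw [ENNReal.le_div_iff_mul_le (Or.inl hπA) (Or.inl (measure_ne_top π A)), mul_comm]
  exact hbound N

lemma exists_tsum_lintegral_avoid_ne_top [IsMarkovKernel P] [IsProbabilityMeasure π]
    (hinv : ∀ A : Set X, MeasurableSet A → ∫⁻ x, P x A ∂π = π A) (hgeom : GeomErgodic P π)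
    {K : Set X} (hK : MeasurableSet K) (hπK : π K ≠ 0) :
    ∃ A ⊆ K, MeasurableSet A ∧ ∑' n, ∫⁻ x, avoid P A (Aᶜ.indicator 1) n x ∂π ≠ ⊤ := by
  obtain ⟨ρ, hρ, ξ, hξ, -, hfin, htv⟩ := hgeom
  obtain ⟨R, hR⟩ : ∃ R : ℕ, π (K ∩ {x | ξ x ≤ R}) ≠ 0 := by
    by_contra! h
    refine hπK (measure_mono_null_ae ?_ (measure_iUnion_null h))
    filter_upwards [hfin] with x hx hxK
    obtain ⟨R, hR⟩ := ENNReal.exists_nat_gt hx.ne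
    exact mem_iUnion.2 ⟨R, hxK, hR.le⟩
  have hA : MeasurableSet (K ∩ {x | ξ x ≤ R}) := hK.inter (measurableSet_le hξ measurable_const)
  refine ⟨_, inter_subset_left, hA, tsum_lintegral_avoid_ne_top hinv hA hR
    (ENNReal.natCast_ne_top R) hρ fun n x hx => (htv n x).trans ?_⟩
  gcongr
  exact hx.2

end AvoidingExpectation

lemma exists_last_visit {p : ℕ → Prop} (h0 : p 0) (n : ℕ) :
    ∃ m k, m + k = n ∧ p m ∧ ∀ i < k, ¬ p (m + 1 + i) := by
  induction n with
  | zero => exact ⟨0, 0, rfl, h0, by simp⟩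
  | succ n ih =>
    by_cases hn : p (n + 1)
    · exact ⟨n + 1, 0, rfl, hn, by simp⟩
    · obtain ⟨m, k, rfl, hm, hk⟩ := ih
      refine ⟨m, k + 1, rfl, hm, fun i hi => ?_⟩
      rcases Nat.lt_succ_iff_lt_or_eq.1 hi with hi | rfl
      · exact hk i hi
      · rwa [add_right_comm]

/-- The paths which are in `K` at time `m`, avoid `K` for the next `k` steps and are in `B` right
after that. -/
def excursion {X Ω : Type*} (Y : ℕ → Ω → X) (K B : Set X) (m k : ℕ) : Set Ω :=
  {ω | Y m ω ∈ K ∧ (∀ i < k, Y (m + 1 + i) ω ∉ K) ∧ Y (m + 1 + k) ω ∈ B}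

namespace IsAdversarial

variable {X Ω : Type*} [MeasurableSpace X] [MetricSpace X] [MeasurableSpace Ω]
  {P : Kernel X X} {K : Set X} {D : ℝ} {x₀ : X} {μ : Measure Ω} {Y : ℕ → Ω → X}

lemma setLIntegral_succ (h : IsAdversarial P K D x₀ μ Y) (n : ℕ) {E : Set Ω}
    (hE : MeasurableSet[MeasurableSpace.comap (fun ω (i : Fin (n + 1)) => Y i ω) inferInstance] E)
    {g : X → ℝ≥0∞} (hg : Measurable g) :
    ∫⁻ ω in E ∩ {ω | Y n ω ∉ K}, g (Y (n + 1) ω) ∂μ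
      = ∫⁻ ω in E ∩ {ω | Y n ω ∉ K}, ∫⁻ y, g y ∂(P (Y n ω)) ∂μ := by
  obtain ⟨hY, -, hmarkov, -⟩ := h
  have hmap : (μ.restrict (E ∩ {ω | Y n ω ∉ K})).map (Y (n + 1))
      = ((μ.restrict (E ∩ {ω | Y n ω ∉ K})).map (Y n)).bind P := by
    ext A hA
    rw [Measure.map_apply (hY _) hA, Measure.restrict_apply (hY _ hA),
      Measure.bind_apply hA P.aemeasurable, lintegral_map (P.measurable_coe hA) (hY n),
      ← hmarkov n A hA E hE, inter_comm]
    rfl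
  rw [← lintegral_map hg (hY _), hmap, Measure.lintegral_bind P.aemeasurable hg.aemeasurable,
    lintegral_map hg.lintegral_kernel (hY n)]

lemma setLIntegral_add (h : IsAdversarial P K D x₀ μ Y) (hK : MeasurableSet K) (k : ℕ)
    {g : X → ℝ≥0∞} (hg : Measurable g) (n : ℕ) {E : Set Ω}
    (hE : MeasurableSet[MeasurableSpace.comap (fun ω (i : Fin (n + 1)) => Y i ω)
      inferInstance] E) :
    ∫⁻ ω in E ∩ {ω | ∀ i < k, Y (n + i) ω ∉ K}, g (Y (n + k) ω) ∂μ
      = ∫⁻ ω in E, avoid P K g k (Y n ω) ∂μ := by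
  induction k generalizing n E with
  | zero => simp [avoid]
  | succ k ih =>
    have hcoord : ∀ j ≤ n + 1, Measurable[MeasurableSpace.comap
        (fun ω (i : Fin (n + 1 + 1)) => Y i ω) inferInstance] (Y j) := fun j hj =>
      (measurable_pi_apply (⟨j, by omega⟩ : Fin (n + 1 + 1))).comp
        (comap_measurable (fun ω (i : Fin (n + 1 + 1)) => Y i ω))
    have hle : MeasurableSpace.comap (fun ω (i : Fin (n + 1)) => Y i ω) inferInstance
        ≤ MeasurableSpace.comap (fun ω (i : Fin (n + 1 + 1)) => Y i ω) inferInstance :=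
      Measurable.comap_le (@measurable_pi_lambda _ _ _ (_) _ _ fun i => hcoord i (by omega))
    have hE' : MeasurableSet[MeasurableSpace.comap (fun ω (i : Fin (n + 1 + 1)) => Y i ω)
        inferInstance] (E ∩ {ω | Y n ω ∉ K}) :=
      (hle _ hE).inter (hcoord n (by omega) hK.compl)
    have hset : E ∩ {ω | ∀ i < k + 1, Y (n + i) ω ∉ K}
        = E ∩ {ω | Y n ω ∉ K} ∩ {ω | ∀ i < k, Y (n + 1 + i) ω ∉ K} := by
      ext ω
      simp only [mem_inter_iff, mem_ofPred_eq, Nat.forall_lt_succ_left, add_zero, and_assoc,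
        add_assoc, add_comm 1]
    have hn : n + (k + 1) = n + 1 + k := by omega
    rw [hset, hn, ih (n + 1) hE', h.setLIntegral_succ n hE (measurable_avoid hK hg k),
      inter_comm, ← setLIntegral_indicator (s := {ω | Y n ω ∉ K}) (h.1 n hK.compl)]
    rfl

lemma measurableSet_excursion (h : IsAdversarial P K D x₀ μ Y) (hK : MeasurableSet K)
    {B : Set X} (hB : MeasurableSet B) (m k : ℕ) : MeasurableSet (excursion Y K B m k) := by
  have : excursion Y K B m k
      = Y m ⁻¹' K ∩ ((⋂ i < k, (Y (m + 1 + i) ⁻¹' K)ᶜ) ∩ Y (m + 1 + k) ⁻¹' B) := by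
    ext
    simp [excursion]
  rw [this]
  exact (h.1 m hK).inter ((MeasurableSet.iInter fun i => MeasurableSet.iInter fun _ =>
    (h.1 _ hK).compl).inter (h.1 _ hB))

lemma measure_excursion (h : IsAdversarial P K D x₀ μ Y) (hK : MeasurableSet K)
    {B : Set X} (hB : MeasurableSet B) (m k : ℕ) :
    μ (excursion Y K B m k)
      = ∫⁻ ω in {ω | Y m ω ∈ K}, avoid P K (B.indicator 1) k (Y (m + 1) ω) ∂μ := by
  have hE : MeasurableSet[MeasurableSpace.comap (fun ω (i : Fin (m + 1 + 1)) => Y i ω)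
      inferInstance] {ω | Y m ω ∈ K} :=
    ((measurable_pi_apply (⟨m, by omega⟩ : Fin (m + 1 + 1))).comp
      (comap_measurable (fun ω (i : Fin (m + 1 + 1)) => Y i ω))) hK
  rw [← h.setLIntegral_add hK k (measurable_one.indicator hB) (m + 1) hE]
  have hind : (fun ω => B.indicator (1 : X → ℝ≥0∞) (Y (m + 1 + k) ω))
      = (Y (m + 1 + k) ⁻¹' B).indicator 1 := rfl
  rw [hind, lintegral_indicator_one (h.1 _ hB), Measure.restrict_apply (h.1 _ hB), inter_comm,
    inter_assoc]
  rfl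

lemma measure_excursion_zero (h : IsAdversarial P K D x₀ μ Y)
    {B : Set X} (hB : Disjoint B (cthickening D K)) (m : ℕ) : μ (excursion Y K B m 0) = 0 :=
  measure_mono_null (fun _ hω =>
    show _ ∧ _ from ⟨hω.1, hB.notMem_of_mem_left hω.2.2⟩) (h.2.2.2 m)

lemma measure_excursion_succ_le (h : IsAdversarial P K D x₀ μ Y) (hK : MeasurableSet K)
    {π : Measure X} {M : ℝ≥0∞} (hP : ∀ x ∈ cthickening D K, P x ≤ M • π)
    {B : Set X} (hB : MeasurableSet B) (m k : ℕ) :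
    μ (excursion Y K B m (k + 1))
      ≤ μ (excursion Y K Kᶜ m 0) * (M * ∫⁻ x, avoid P K (B.indicator 1) k x ∂π) := by
  have hstep : ∀ᵐ ω ∂(μ.restrict {ω | Y m ω ∈ K}), Y (m + 1) ω ∈ cthickening D K := by
    rw [ae_restrict_iff' (s := {ω | Y m ω ∈ K}) (h.1 m hK), ae_iff]
    refine measure_mono_null (fun ω hω => ?_) (h.2.2.2 m)
    simpa using hω
  rw [h.measure_excursion hK hB, h.measure_excursion hK hK.compl]
  refine le_trans (lintegral_mono_ae ?_) (lintegral_mul_const _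
    ((measurable_avoid hK (measurable_one.indicator hK.compl) 0).comp (h.1 (m + 1)))).le
  filter_upwards [hstep] with ω hω
  by_cases hωK : Y (m + 1) ω ∈ K
  · simp [avoid, hωK]
  · simp only [avoid, Function.comp_apply, mem_compl_iff, hωK, not_false_eq_true,
      indicator_of_mem, Pi.one_apply, one_mul]
    exact (lintegral_mono' (hP _ hω) le_rfl).trans (lintegral_smul_measure _ _).le

lemma measure_le_sum_excursion (h : IsAdversarial P K D x₀ μ Y) (hx₀ : x₀ ∈ K) (B : Set X)
    (n : ℕ) :
    μ {ω | Y (n + 1) ω ∈ B}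
      ≤ ∑ p ∈ Finset.HasAntidiagonal.antidiagonal n, μ (excursion Y K B p.1 p.2) := by
  refine (measure_mono fun ω hω => ?_).trans (measure_biUnion_finset_le _ _)
  obtain ⟨m, k, hmk, hm, hk⟩ :=
    exists_last_visit (p := fun j => Y j ω ∈ K) (by simpa [h.2.1] using hx₀) n
  refine mem_biUnion (x := (m, k)) (by simpa using hmk) ⟨hm, hk, ?_⟩
  have : m + 1 + k = n + 1 := by omega
  rwa [this]

/-- If `K` is null for the invariant measure then the process almost surely leaves `K` at most
once. -/
lemma tsum_measure_exit_le_one [IsProbabilityMeasure μ] (h : IsAdversarial P K D x₀ μ Y)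
    (hK : MeasurableSet K) {π : Measure X}
    (hinv : ∀ A : Set X, MeasurableSet A → ∫⁻ x, P x A ∂π = π A)
    {M : ℝ≥0∞} (hP : ∀ x ∈ cthickening D K, P x ≤ M • π) (hπK : π K = 0) :
    ∑' m, μ (excursion Y K Kᶜ m 0) ≤ 1 := by
  have hnull : ∀ m k, μ (excursion Y K K m (k + 1)) = 0 := by
    intro m k
    have h0 : ∫⁻ x, avoid P K (K.indicator 1) k x ∂π = 0 := by
      refine le_antisymm ((lintegral_avoid_le hinv hK (measurable_one.indicator hK) k).trans ?_)
        zero_le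
      rw [lintegral_indicator_one hK, hπK]
    simpa [h0] using h.measure_excursion_succ_le hK hP hK m k
  have hlt : ∀ m j, m < j → μ (excursion Y K Kᶜ m 0 ∩ excursion Y K Kᶜ j 0) = 0 := by
    intro m j hmj
    refine measure_mono_null (fun ω hω => ?_) (measure_iUnion_null (hnull m))
    obtain ⟨⟨hm, -, hm1⟩, hj, -⟩ := hω
    have hex : ∃ k, Y (m + 1 + k) ω ∈ K :=
      ⟨j - (m + 1), by rwa [show m + 1 + (j - (m + 1)) = j by omega]⟩
    classical
    obtain ⟨k, hk⟩ : ∃ k, Nat.find hex = k + 1 := by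
      refine Nat.exists_eq_succ_of_ne_zero fun h0 => hm1 ?_
      simpa [h0] using Nat.find_spec hex
    exact mem_iUnion.2 ⟨k, hm, fun i hi => Nat.find_min hex (hk ▸ hi), hk ▸ Nat.find_spec hex⟩
  rw [← measure_iUnion₀ ?_ fun m => (h.measurableSet_excursion hK hK.compl m 0).nullMeasurableSet]
  · exact prob_le_one
  · intro m j hmj
    rcases lt_or_gt_of_ne hmj with hlt' | hlt'
    · exact hlt m j hlt'
    · exact (inter_comm _ _ ▸ hlt j m hlt' :)

end IsAdversarial

lemma kernel_le_smul_of_bounded_jumps {X : Type*} [MeasurableSpace X] [MetricSpace X]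
    [BorelSpace X] {P : Kernel X X} [IsMarkovKernel P] {π : Measure X} {D : ℝ} (hD : 0 ≤ D)
    (hjump : ∀ x, P x {y | dist x y ≤ D} = 1) {K : Set X} {M : ℝ≥0∞}
    (hdom : ∀ x ∈ cthickening D K, ∀ A : Set X, A ⊆ cthickening (2 * D) K →
        MeasurableSet A → P x A ≤ M * π A)
    {x : X} (hx : x ∈ cthickening D K) : P x ≤ M • π := by
  have hball : {y | dist x y ≤ D} = closedBall x D := by ext; simp [dist_comm]
  have hmeas : MeasurableSet {y | dist x y ≤ D} := hball ▸ isClosed_closedBall.measurableSet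
  have hsub : {y | dist x y ≤ D} ⊆ cthickening (2 * D) K := by
    rw [hball, two_mul]
    exact (closedBall_subset_cthickening hx D).trans (cthickening_cthickening_subset hD hD K)
  refine Measure.le_iff.2 fun A hA => ?_
  have hae : ∀ᵐ y ∂(P x), y ∈ {y | dist x y ≤ D} := by
    exact (prob_compl_eq_zero_iff hmeas).2 (hjump x)
  calc P x A = P x (A ∩ {y | dist x y ≤ D}) :=
        (measure_inter_conull hae).symm
    _ ≤ M * π (A ∩ {y | dist x y ≤ D}) :=
        hdom x hx _ (inter_subset_right.trans hsub) (hA.inter hmeas)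
    _ ≤ M * π A := by gcongr; exact inter_subset_left
    _ = (M • π) A := by simp

lemma tendsto_measure_lt_dist {X : Type*} [MeasurableSpace X] [MetricSpace X] [BorelSpace X]
    (π : Measure X) [IsFiniteMeasure π] (o : X) :
    Tendsto (fun L : ℝ => π {x | L < dist x o}) atTop (𝓝 0) := by
  have hempty : ⋂ L : ℝ, {x : X | L < dist x o} = ∅ :=
    eq_empty_of_forall_notMem fun x hx =>
      lt_irrefl (dist x o) (mem_iInter.1 hx (dist x o))
  rw [← measure_empty (μ := π), ← hempty]
  refine tendsto_measure_iInter_atTop (fun L => ?_) (fun L L' hL x hx => lt_of_le_of_lt hL hx)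
    ⟨0, measure_ne_top _ _⟩
  exact (measurableSet_lt measurable_const (continuous_id.dist continuous_const).measurable
    ).nullMeasurableSet

lemma ENNReal.tendsto_tsum_zero_of_dominated {ι : Type*} {l : Filter ι} [l.IsCountablyGenerated]
    {f : ι → ℕ → ℝ≥0∞} {bound : ℕ → ℝ≥0∞} (hbound : ∑' k, bound k ≠ ⊤)
    (hle : ∀ᶠ i in l, ∀ k, f i k ≤ bound k) (hf : ∀ k, Tendsto (fun i => f i k) l (𝓝 0)) :
    Tendsto (fun i => ∑' k, f i k) l (𝓝 0) := by
  have := tendsto_lintegral_filter_of_dominated_convergence (μ := Measure.count) (l := l)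
    (F := f) (f := fun _ => 0) bound (Eventually.of_forall fun _ => measurable_of_countable _)
    (hle.mono fun i hi => ae_of_all _ hi)
    (by rwa [lintegral_count]) (ae_of_all _ hf)
  simpa [lintegral_count] using this

/-- Theorem 7 (thm-geomerg): under (A4) (geometric ergodicity) and (A5), every
adversarial process is bounded in probability. -/
theorem adversarial_bounded_of_A4_A5
    {𝒳 : Type*} [MeasurableSpace 𝒳] [MetricSpace 𝒳] [BorelSpace 𝒳] (o : 𝒳)
    (P : Kernel 𝒳 𝒳) [IsMarkovKernel P] (π : Measure 𝒳) [IsProbabilityMeasure π]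
    (hErg : HarrisErgodic P π)
    (D : ℝ) (hD : 0 < D) (hjump : ∀ x, P x {y | dist x y ≤ D} = 1)
    (K : Set 𝒳) (hKmeas : MeasurableSet K) (hKne : K.Nonempty)
    (hKbdd : Bornology.IsBounded K)
    -- (A4): P is geometrically ergodic
    (hA4 : GeomErgodic P π)
    -- (A5): P(x,dz) ≤ M π(dz) for all x ∈ K_D and z ∈ K_{2D}
    (M : ℝ≥0∞) (hM : M ≠ ⊤)
    (hA5 : ∀ x ∈ cthickening D K, ∀ A : Set 𝒳, A ⊆ cthickening (2 * D) K →
        MeasurableSet A → P x A ≤ M * π A)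
    -- the adversarial process
    {Ω : Type*} [MeasurableSpace Ω] (μ : Measure Ω) [IsProbabilityMeasure μ]
    (x₀ : 𝒳) (hx₀ : x₀ ∈ K) (Xp : ℕ → Ω → 𝒳)
    (hadv : IsAdversarial P K D x₀ μ Xp) :
    BoundedInProb μ Xp o := by
  have hinv := hErg.1
  have hP : ∀ x ∈ cthickening D K, P x ≤ M • π := fun x hx =>
    kernel_le_smul_of_bounded_jumps hD.le hjump hA5 hx
  set B : ℝ → Set 𝒳 := fun L => {x | L < dist x o}
  have hB : ∀ L, MeasurableSet (B L) := fun L =>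
    measurableSet_lt measurable_const (continuous_id.dist continuous_const).measurable
  set c : ℝ → ℕ → ℝ≥0∞ := fun L k => ∫⁻ x, avoid P K ((B L).indicator 1) k x ∂π
  have hcB : ∀ L k, c L k ≤ π (B L) := fun L k =>
    (lintegral_avoid_le hinv hKmeas (measurable_one.indicator (hB L)) k).trans
      (lintegral_indicator_one (hB L)).le
  have hB0 : Tendsto (fun L => π (B L)) atTop (𝓝 0) := tendsto_measure_lt_dist π o
  obtain ⟨L₀, hL₀⟩ := (hKbdd.cthickening (δ := D)).subset_closedBall o
  have hdisj : ∀ L ≥ L₀, Disjoint (B L) (cthickening D K) := fun L hL =>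
    disjoint_left.2 fun x hx hxK => (hL.trans_lt hx).not_ge (hL₀ hxK)
  have hexc : ∀ L ≥ L₀, ∀ m k, μ (excursion Xp K (B L) m k)
      ≤ μ (excursion Xp K Kᶜ m 0) * (M * c L (k - 1)) := by
    intro L hL m k
    cases k with
    | zero => simp [hadv.measure_excursion_zero (hdisj L hL) m]
    | succ k => exact hadv.measure_excursion_succ_le hKmeas hP (hB L) m k
  have hreduce : ∀ φ : ℝ → ℝ≥0∞, Tendsto φ atTop (𝓝 0) →
      (∀ L ≥ L₀, ∀ n, ∑ p ∈ Finset.HasAntidiagonal.antidiagonal n,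
        μ (excursion Xp K Kᶜ p.1 0) * (M * c L (p.2 - 1)) ≤ φ L) → BoundedInProb μ Xp o := by
    intro φ hφ hle
    refine tendsto_of_tendsto_of_tendsto_of_le_of_le' tendsto_const_nhds hφ
      (Eventually.of_forall fun _ => zero_le) ?_
    filter_upwards [eventually_ge_atTop L₀] with L hL
    refine iSup_le fun n => ?_
    cases n with
    | zero =>
      have : ¬ L < dist x₀ o :=
        (disjoint_left.1 (hdisj L hL)).mt (not_not.2 (self_subset_cthickening K hx₀))
      simp [hadv.2.1, this]
    | succ n =>
      exact (hadv.measure_le_sum_excursion hx₀ (B L) n).trans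
        ((Finset.sum_le_sum fun p _ => hexc L hL p.1 p.2).trans (hle L hL n))
  by_cases hπK : π K = 0
  · refine hreduce (fun L => M * π (B L))
      (by simpa using ENNReal.Tendsto.const_mul hB0 (Or.inr hM)) fun L _ n => ?_
    calc _ ≤ ∑ p ∈ Finset.HasAntidiagonal.antidiagonal n, μ (excursion Xp K Kᶜ p.1 0) * (M * π (B L)) := by
          gcongr; exact hcB L _
      _ = (∑ m ∈ Finset.range (n + 1), μ (excursion Xp K Kᶜ m 0)) * (M * π (B L)) := by
          rw [Finset.sum_mul, Finset.Nat.sum_antidiagonal_eq_sum_range_succ_mk]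
      _ ≤ 1 * (M * π (B L)) := by
          gcongr
          exact (ENNReal.sum_le_tsum _).trans
            (hadv.tsum_measure_exit_le_one hKmeas hinv hP hπK)
      _ = _ := one_mul _
  · obtain ⟨A, hAK, -, hsum⟩ := exists_tsum_lintegral_avoid_ne_top hinv hA4 hKmeas hπK
    have hlim : Tendsto (fun L => ∑' k, c L (k - 1)) atTop (𝓝 0) := by
      refine ENNReal.tendsto_tsum_zero_of_dominated
        (bound := fun k => ∫⁻ x, avoid P A (Aᶜ.indicator 1) (k - 1) x ∂π) ?_ ?_ fun k =>
        tendsto_of_tendsto_of_tendsto_of_le_of_le tendsto_const_nhds hB0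
          (fun _ => zero_le) fun L => hcB L (k - 1)
      · rw [tsum_eq_zero_add' ENNReal.summable]
        exact ENNReal.add_ne_top.2 ⟨ne_top_of_le_ne_top hsum (ENNReal.le_tsum 0), hsum⟩
      · filter_upwards [eventually_ge_atTop L₀] with L hL k
        refine lintegral_mono (avoid_mono hAK (indicator_le_indicator_of_subset ?_
          fun _ => zero_le) _)
        exact fun x hx hxA =>
          disjoint_left.1 (hdisj L hL) hx (self_subset_cthickening K (hAK hxA))
    refine hreduce (fun L => M * ∑' k, c L (k - 1))
      (by simpa using ENNReal.Tendsto.const_mul hlim (Or.inr hM)) fun L _ n => ?_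
    calc _ ≤ ∑ p ∈ Finset.HasAntidiagonal.antidiagonal n, M * c L (p.2 - 1) :=
          Finset.sum_le_sum fun p _ => mul_le_of_le_one_left' prob_le_one
      _ = M * ∑ k ∈ Finset.range (n + 1), c L (k - 1) := by
          rw [← Finset.mul_sum, ← Finset.Nat.sum_antidiagonal_swap,
            Finset.Nat.sum_antidiagonal_eq_sum_range_succ_mk]
          rfl
      _ ≤ _ := by gcongr; exact ENNReal.sum_le_tsum _
end

section
/- Consider a φ-irreducible Markov chain on a measurable space (𝒳, ℱ) with transition kernel P and stationary probability distribution π. Let B, C ∈ ℱ with π(B) > 0 and π(C) > 0, and let μ be a probability measure on (𝒳, ℱ). Suppose C is a small set for P with minorizing measure μ: there are ε > 0 and n₀ ∈ ℕ such that P^{n₀}(x, A) ≥ ε μ(A) for all x ∈ C and all A ∈ ℱ. Then the expected hitting time of B starting from the initial distribution μ is finite: 𝔼_μ(τ_B) < ∞. -/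
open MeasureTheory ProbabilityTheory Filter Metric Set
open scoped ENNReal Topology

/-- The action of a kernel on nonnegative functions, `f ↦ (x ↦ ∫ f dP(x, ·))`. -/
noncomputable def kernelAvg {X : Type*} [MeasurableSpace X] (P : Kernel X X) (f : X → ℝ≥0∞)
    (x : X) : ℝ≥0∞ :=
  ∫⁻ y, f y ∂(P x)

/-- The action of the kernel killed on entering `B`. -/
noncomputable def tabooAvg {X : Type*} [MeasurableSpace X] (P : Kernel X X) (B : Set X)
    (f : X → ℝ≥0∞) : X → ℝ≥0∞ :=
  kernelAvg P (Bᶜ.indicator f)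

/-- The expected hitting time of `B`, as a function of the starting point. -/
noncomputable def expHit {X : Type*} [MeasurableSpace X] (P : Kernel X X) (B : Set X)
    (x : X) : ℝ≥0∞ :=
  ∑' n : ℕ, (tabooAvg P B)^[n] 1 x

section KernelAvg

variable {X : Type*} [MeasurableSpace X] {P : Kernel X X} {π : Measure X} {B : Set X}
  {f g : X → ℝ≥0∞}

lemma measurable_kernelAvg (hf : Measurable f) : Measurable (kernelAvg P f) :=
  hf.lintegral_kernel

lemma measurable_kernelAvg_iterate (hf : Measurable f) (n : ℕ) :
    Measurable ((kernelAvg P)^[n] f) := by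
  induction n generalizing f with
  | zero => exact hf
  | succ n ih => exact ih (measurable_kernelAvg hf)

lemma kernelAvg_mono (h : f ≤ g) : kernelAvg P f ≤ kernelAvg P g :=
  fun _ => lintegral_mono h

lemma kernelAvg_iterate_mono (h : f ≤ g) (n : ℕ) :
    (kernelAvg P)^[n] f ≤ (kernelAvg P)^[n] g :=
  Monotone.iterate (fun _ _ => kernelAvg_mono) n h

lemma kernelAvg_add (hf : Measurable f) : kernelAvg P (f + g) = kernelAvg P f + kernelAvg P g := by
  ext x
  exact lintegral_add_left hf _

lemma kernelAvg_iterate_add (hf : Measurable f) (hg : Measurable g) (n : ℕ) :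
    (kernelAvg P)^[n] (f + g) = (kernelAvg P)^[n] f + (kernelAvg P)^[n] g := by
  induction n generalizing f g with
  | zero => rfl
  | succ n ih =>
    simp only [Function.iterate_succ_apply]
    rw [kernelAvg_add hf, ih (measurable_kernelAvg hf) (measurable_kernelAvg hg)]

lemma lintegral_iterK_s10 (hf : Measurable f) (n : ℕ) (x : X) :
    ∫⁻ y, f y ∂(iterK P n x) = (kernelAvg P)^[n] f x := by
  induction n generalizing f with
  | zero => simp [iterK, Kernel.lintegral_deterministic' _ hf]
  | succ n ih =>
    rw [iterK, Kernel.lintegral_comp _ _ _ hf, Function.iterate_succ_apply,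
      ← ih (measurable_kernelAvg hf)]
    rfl

lemma iterK_apply_eq {A : Set X} (hA : MeasurableSet A) (n : ℕ) (x : X) :
    iterK P n x A = (kernelAvg P)^[n] (A.indicator 1) x := by
  rw [← lintegral_iterK_s10 (measurable_one.indicator hA), lintegral_indicator_one hA]

lemma lintegral_kernelAvg_of_invariant (hinv : π.bind P = π) (hf : Measurable f) :
    ∫⁻ x, kernelAvg P f x ∂π = ∫⁻ x, f x ∂π := by
  conv_rhs => rw [← hinv, Measure.lintegral_bind P.aemeasurable hf.aemeasurable]
  rfl

lemma lintegral_kernelAvg_iterate_of_invariant (hinv : π.bind P = π) (hf : Measurable f) (n : ℕ) :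
    ∫⁻ x, (kernelAvg P)^[n] f x ∂π = ∫⁻ x, f x ∂π := by
  induction n generalizing f with
  | zero => rfl
  | succ n ih =>
    rw [Function.iterate_succ_apply, ih (measurable_kernelAvg hf),
      lintegral_kernelAvg_of_invariant hinv hf]

lemma measurable_tabooAvg (hB : MeasurableSet B) (hf : Measurable f) :
    Measurable (tabooAvg P B f) :=
  measurable_kernelAvg (hf.indicator hB.compl)

lemma measurable_tabooAvg_iterate (hB : MeasurableSet B) (hf : Measurable f) (n : ℕ) :
    Measurable ((tabooAvg P B)^[n] f) := by
  induction n generalizing f with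
  | zero => exact hf
  | succ n ih => exact ih (measurable_tabooAvg hB hf)

lemma measurable_expHit (hB : MeasurableSet B) : Measurable (expHit P B) :=
  Measurable.tsum fun n => measurable_tabooAvg_iterate hB measurable_one n

lemma tabooAvg_expHit_le (hB : MeasurableSet B) : tabooAvg P B (expHit P B) ≤ expHit P B := by
  intro x
  have h : tabooAvg P B (expHit P B) x = ∑' n : ℕ, (tabooAvg P B)^[n + 1] 1 x := by
    simp only [Function.iterate_succ_apply']
    simp only [tabooAvg, kernelAvg, lintegral_indicator hB.compl]
    exact lintegral_tsum fun n => (measurable_tabooAvg_iterate hB measurable_one n).aemeasurable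
  rw [h]
  exact ENNReal.tsum_comp_le_tsum_of_injective (add_left_injective 1) _

lemma kernelAvg_expHit_le (hB : MeasurableSet B) :
    kernelAvg P (expHit P B) ≤ expHit P B + kernelAvg P (B.indicator (expHit P B)) := by
  have h : kernelAvg P (expHit P B)
      = tabooAvg P B (expHit P B) + kernelAvg P (B.indicator (expHit P B)) := by
    rw [tabooAvg, ← kernelAvg_add ((measurable_expHit hB).indicator hB.compl),
      indicator_compl_add_self]
  rw [h]
  exact add_le_add_left (tabooAvg_expHit_le hB) _

/-- **Kac's inequality**: the expected return time to `B`, integrated over `B` against an invariant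
probability measure, is at most one. -/
lemma setLIntegral_expHit_le_one [IsProbabilityMeasure π] (hinv : π.bind P = π)
    (hB : MeasurableSet B) : ∫⁻ x in B, expHit P B x ∂π ≤ 1 := by
  have hu := fun n => measurable_tabooAvg_iterate (P := P) hB measurable_one n
  have key : ∀ N : ℕ, ∑ n ∈ Finset.range N, ∫⁻ x in B, (tabooAvg P B)^[n] 1 x ∂π
      + ∫⁻ x, (tabooAvg P B)^[N] 1 x ∂π = 1 := by
    intro N
    induction N with
    | zero => simp
    | succ N ih =>
      have hstep : ∫⁻ x, (tabooAvg P B)^[N + 1] 1 x ∂π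
          = ∫⁻ x in Bᶜ, (tabooAvg P B)^[N] 1 x ∂π := by
        rw [Function.iterate_succ_apply', ← lintegral_indicator hB.compl]
        exact lintegral_kernelAvg_of_invariant hinv ((hu N).indicator hB.compl)
      rw [Finset.sum_range_succ, hstep, add_assoc, lintegral_add_compl _ hB, ih]
  have hsum : ∫⁻ x in B, expHit P B x ∂π
      = ∑' n : ℕ, ∫⁻ x in B, (tabooAvg P B)^[n] 1 x ∂π :=
    lintegral_tsum fun n => (hu n).aemeasurable
  rw [hsum]
  exact ENNReal.tsum_le_of_sum_range_le fun N => le_self_add.trans (key N).le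

/-- Almost every point at which the expected hitting time is finite is such that the expected
hitting time stays integrable after any number of steps. -/
lemma ae_kernelAvg_iterate_expHit_lt_top [IsProbabilityMeasure π] (hinv : π.bind P = π)
    (hB : MeasurableSet B) :
    ∀ᵐ x ∂π, expHit P B x < ⊤ → ∀ n, (kernelAvg P)^[n] (expHit P B) x < ⊤ := by
  have hg := measurable_expHit (P := P) hB
  have hh := measurable_kernelAvg (P := P) (hg.indicator hB)
  have hfin : ∀ᵐ x ∂π, ∀ n,
      (kernelAvg P)^[n] (kernelAvg P (B.indicator (expHit P B))) x < ⊤ := by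
    refine ae_all_iff.2 fun n => ae_lt_top (measurable_kernelAvg_iterate hh n) ?_
    rw [lintegral_kernelAvg_iterate_of_invariant hinv hh,
      lintegral_kernelAvg_of_invariant hinv (hg.indicator hB), lintegral_indicator hB]
    exact ((setLIntegral_expHit_le_one hinv hB).trans_lt ENNReal.one_lt_top).ne
  filter_upwards [hfin] with x hx h0 n
  induction n with
  | zero => exact h0
  | succ n ih =>
    rw [Function.iterate_succ_apply]
    refine (kernelAvg_iterate_mono (kernelAvg_expHit_le hB) n x).trans_lt ?_
    rw [kernelAvg_iterate_add hg hh]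
    exact ENNReal.add_lt_top.2 ⟨ih, hx n⟩

/-- For a `φ`-irreducible chain, a nonempty absorbing set has full measure under every invariant
probability measure. -/
lemma measure_compl_eq_zero_of_absorbing [IsMarkovKernel P] [IsProbabilityMeasure π]
    (hinv : π.bind P = π) {φ : Measure X} (hφ : φ ≠ 0)
    (hirr : ∀ A : Set X, MeasurableSet A → 0 < φ A → ∀ x : X, ∃ n : ℕ, 1 ≤ n ∧ 0 < iterK P n x A)
    {S : Set X} (hS : MeasurableSet S) (habs : ∀ x ∈ S, P x Sᶜ = 0) (hne : S.Nonempty) :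
    π Sᶜ = 0 := by
  have hstep : kernelAvg P (Sᶜ.indicator 1) ≤ Sᶜ.indicator 1 := by
    intro x
    rw [kernelAvg, lintegral_indicator_one hS.compl]
    by_cases hx : x ∈ S
    · simp [hx, habs x hx]
    · simpa [hx] using prob_le_one
  have hstep' : S.indicator 1 ≤ kernelAvg P (S.indicator 1) := by
    intro x
    rw [kernelAvg, lintegral_indicator_one hS]
    by_cases hx : x ∈ S
    · simp [hx, (prob_compl_eq_zero_iff hS).1 (habs x hx)]
    · simp [hx]
  have hout : ∀ n, (kernelAvg P)^[n] (Sᶜ.indicator 1) ≤ Sᶜ.indicator 1 := by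
    intro n
    induction n with
    | zero => exact le_rfl
    | succ n ih =>
      rw [Function.iterate_succ_apply]
      exact (kernelAvg_iterate_mono hstep n).trans ih
  have hin : ∀ n, S.indicator 1 ≤ (kernelAvg P)^[n] (S.indicator 1) := by
    intro n
    induction n with
    | zero => exact le_rfl
    | succ n ih =>
      rw [Function.iterate_succ_apply]
      exact ih.trans (kernelAvg_iterate_mono hstep' n)
  have hφc : φ Sᶜ = 0 := by
    by_contra h
    obtain ⟨x, hx⟩ := hne
    obtain ⟨n, -, hn⟩ := hirr _ hS.compl (pos_iff_ne_zero.2 h) x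
    rw [iterK_apply_eq hS.compl] at hn
    exact (hn.trans_le (hout n x)).ne' (by simp [hx])
  have hφS : 0 < φ S := by
    refine pos_iff_ne_zero.2 fun h => hφ (Measure.measure_univ_eq_zero.1 ?_)
    rw [← union_compl_self S]
    exact measure_union_null h hφc
  have hmeas : Measurable (S.indicator (1 : X → ℝ≥0∞)) := measurable_one.indicator hS
  have hae : ∀ᵐ x ∂π, ∀ n, S.indicator 1 x = (kernelAvg P)^[n] (S.indicator 1) x := by
    refine ae_all_iff.2 fun n => ?_
    refine ae_eq_of_ae_le_of_lintegral_le (.of_forall (hin n)) ?_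
      (measurable_kernelAvg_iterate hmeas n).aemeasurable
      (lintegral_kernelAvg_iterate_of_invariant hinv hmeas n).le
    rw [lintegral_indicator_one hS]
    exact measure_ne_top _ _
  refine mem_ae_iff.1 ?_
  filter_upwards [hae] with x hall
  by_contra hx
  obtain ⟨n, -, hn⟩ := hirr S hS hφS x
  rw [iterK_apply_eq hS, ← hall n, indicator_of_notMem hx] at hn
  exact lt_irrefl _ hn

lemma ae_forall_kernelAvg_iterate_expHit_lt_top [IsMarkovKernel P] [IsProbabilityMeasure π]
    (hinv : π.bind P = π) {φ : Measure X} (hφ : φ ≠ 0)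
    (hirr : ∀ A : Set X, MeasurableSet A → 0 < φ A → ∀ x : X, ∃ n : ℕ, 1 ≤ n ∧ 0 < iterK P n x A)
    (hB : MeasurableSet B) (hπB : 0 < π B) :
    ∀ᵐ x ∂π, ∀ n, (kernelAvg P)^[n] (expHit P B) x < ⊤ := by
  have hmeas := measurable_kernelAvg_iterate (P := P) (measurable_expHit (P := P) hB)
  set S : Set X := {x | ∀ n, (kernelAvg P)^[n] (expHit P B) x < ⊤} with hSdef
  have hS : MeasurableSet S := by
    rw [hSdef, ofPred_forall]
    exact MeasurableSet.iInter fun n => measurableSet_lt (hmeas n) measurable_const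
  refine measure_compl_eq_zero_of_absorbing hinv hφ hirr hS (fun x hx => ?_) ?_
  · change ∀ᵐ y ∂(P x), ∀ n, (kernelAvg P)^[n] (expHit P B) y < ⊤
    refine ae_all_iff.2 fun n => ae_lt_top (hmeas n) ?_
    have := hx (n + 1)
    rw [Function.iterate_succ_apply'] at this
    exact this.ne
  · have hfin : ∀ᵐ x ∂π.restrict B, expHit P B x < ⊤ :=
      ae_lt_top (measurable_expHit hB)
        ((setLIntegral_expHit_le_one hinv hB).trans_lt ENNReal.one_lt_top).ne
    have hne : (ae (π.restrict B)).NeBot := by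
      rw [ae_neBot, Ne, Measure.restrict_eq_zero]
      exact hπB.ne'
    obtain ⟨x, h1, h2⟩ :=
      (hfin.and (ae_restrict_of_ae (ae_kernelAvg_iterate_expHit_lt_top hinv hB))).exists
    exact ⟨x, h2 h1⟩

end KernelAvg

lemma hitTime_le_tsum {X Ω : Type*} (Y : ℕ → Ω → X) (B : Set X) (ω : Ω) :
    hitTime Y B ω
      ≤ ∑' n : ℕ, {ω | ∀ k, 1 ≤ k → k ≤ n → Y k ω ∉ B}.indicator (1 : Ω → ℝ≥0∞) ω := by
  classical
  by_cases h : ∃ n, 1 ≤ n ∧ Y n ω ∈ B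
  · refine (iInf₂_le (Nat.find h) (Nat.find_spec h)).trans ?_
    refine le_trans (le_of_eq ?_) (ENNReal.sum_le_tsum (Finset.range (Nat.find h)))
    rw [Finset.sum_congr rfl (g := fun _ => (1 : ℝ≥0∞)), Finset.sum_const, Finset.card_range,
      nsmul_one]
    intro n hn
    refine indicator_of_mem (fun k hk hkn hkB => ?_) _
    exact Nat.find_min h (hkn.trans_lt (Finset.mem_range.1 hn)) ⟨hk, hkB⟩
  · push Not at h
    have : ∀ n : ℕ,
        {ω | ∀ k, 1 ≤ k → k ≤ n → Y k ω ∉ B}.indicator (1 : Ω → ℝ≥0∞) ω = 1 :=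
      fun n => indicator_of_mem (mem_ofPred.2 fun k hk _ => h k hk) _
    simp [this]

lemma measurableSet_comap_avoid {X Ω : Type*} [MeasurableSpace X] {Y : ℕ → Ω → X} {B : Set X}
    (hB : MeasurableSet B) (n : ℕ) :
    MeasurableSet[MeasurableSpace.comap (fun ω (i : Fin (n + 1)) => Y i ω) inferInstance]
      {ω | ∀ k, 1 ≤ k → k ≤ n → Y k ω ∉ B} := by
  refine ⟨{y | ∀ i : Fin (n + 1), 1 ≤ (i : ℕ) → y i ∉ B}, ?_, ?_⟩
  · simp only [ofPred_forall]
    exact MeasurableSet.iInter fun i => MeasurableSet.iInter fun _ =>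
      (measurable_pi_apply i : Measurable fun y : Fin (n + 1) → X => y i) hB.compl
  · ext ω
    exact ⟨fun h k hk hkn => h ⟨k, Nat.lt_succ_of_le hkn⟩ hk,
      fun h i hi => h i hi (Nat.le_of_lt_succ i.2)⟩

section Realization

variable {X Ω : Type*} [MeasurableSpace X] [MeasurableSpace Ω] {P : Kernel X X} {ν : Measure X}
  {μ : Measure Ω} {Y : ℕ → Ω → X} {B : Set X}

lemma IsMarkovReal.setLIntegral_succ (hmc : IsMarkovReal P ν μ Y) (n : ℕ) {E : Set Ω}
    (hE : MeasurableSet[MeasurableSpace.comap (fun ω (i : Fin (n + 1)) => Y i ω) inferInstance] E)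
    {f : X → ℝ≥0∞} (hf : Measurable f) :
    ∫⁻ ω in E, f (Y (n + 1) ω) ∂μ = ∫⁻ ω in E, kernelAvg P f (Y n ω) ∂μ := by
  obtain ⟨hY, -, hstep⟩ := hmc
  have hmap : (μ.restrict E).map (Y (n + 1)) = ((μ.restrict E).map (Y n)).bind P := by
    ext A hA
    rw [Measure.map_apply (hY _) hA, Measure.restrict_apply (hY _ hA),
      Measure.bind_apply hA P.aemeasurable, lintegral_map (P.measurable_coe hA) (hY n), inter_comm]
    exact hstep n A hA E hE
  rw [← lintegral_map hf (hY (n + 1)), hmap,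
    Measure.lintegral_bind P.aemeasurable hf.aemeasurable,
    ← lintegral_map (measurable_kernelAvg hf) (hY n)]
  rfl

lemma IsMarkovReal.setLIntegral_avoid (hmc : IsMarkovReal P ν μ Y) (hB : MeasurableSet B) (n : ℕ)
    {f : X → ℝ≥0∞} (hf : Measurable f) :
    ∫⁻ ω in {ω | ∀ k, 1 ≤ k → k ≤ n → Y k ω ∉ B}, f (Y n ω) ∂μ
      = ∫⁻ x, (tabooAvg P B)^[n] f x ∂ν := by
  induction n generalizing f with
  | zero =>
    have huniv : {ω | ∀ k, 1 ≤ k → k ≤ 0 → Y k ω ∉ B} = univ :=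
      eq_univ_of_forall fun ω k hk hk0 => absurd (hk.trans hk0) (by simp)
    rw [huniv, Measure.restrict_univ, ← hmc.2.1, Function.iterate_zero, id_eq,
      lintegral_map hf (hmc.1 0)]
  | succ n ih =>
    have hsplit : {ω | ∀ k, 1 ≤ k → k ≤ n + 1 → Y k ω ∉ B}
        = Y (n + 1) ⁻¹' Bᶜ ∩ {ω | ∀ k, 1 ≤ k → k ≤ n → Y k ω ∉ B} := by
      ext ω
      refine ⟨fun h => ⟨h _ (by simp) le_rfl, fun k hk hkn => h k hk (by lia)⟩, ?_⟩
      rintro ⟨h1, h2⟩ k hk hkn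
      rcases hkn.lt_or_eq with h | rfl
      · exact h2 k hk (Nat.le_of_lt_succ h)
      · exact h1
    rw [Function.iterate_succ_apply, ← ih (measurable_tabooAvg hB hf), tabooAvg,
      ← hmc.setLIntegral_succ n (measurableSet_comap_avoid hB n) (hf.indicator hB.compl), hsplit,
      ← Measure.restrict_restrict (hmc.1 _ hB.compl),
      ← lintegral_indicator (hmc.1 _ hB.compl)]
    rfl

lemma IsMarkovReal.lintegral_hitTime_le (hmc : IsMarkovReal P ν μ Y) (hB : MeasurableSet B) :
    ∫⁻ ω, hitTime Y B ω ∂μ ≤ ∫⁻ x, expHit P B x ∂ν := by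
  have hE : ∀ n : ℕ, MeasurableSet {ω | ∀ k, 1 ≤ k → k ≤ n → Y k ω ∉ B} := fun n =>
    (measurable_pi_lambda _ fun i : Fin (n + 1) => hmc.1 i).comap_le _
      (measurableSet_comap_avoid hB n)
  refine (lintegral_mono (hitTime_le_tsum Y B)).trans (le_of_eq ?_)
  rw [lintegral_tsum fun n => (measurable_one.indicator (hE n)).aemeasurable]
  have hsum : ∫⁻ x, expHit P B x ∂ν = ∑' n : ℕ, ∫⁻ x, (tabooAvg P B)^[n] 1 x ∂ν :=
    lintegral_tsum fun n => (measurable_tabooAvg_iterate hB measurable_one n).aemeasurable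
  rw [hsum]
  refine tsum_congr fun n => ?_
  rw [← hmc.setLIntegral_avoid hB n measurable_one, lintegral_indicator (hE n)]
  rfl

end Realization

/-- Lemma 12 (MChitting): for a φ-irreducible Markov chain with stationary probability
distribution π, if C is a small set with minorizing measure μ₀ and π(B), π(C) > 0, then
the expected hitting time of B starting from μ₀ is finite. -/
theorem finite_expected_hitting_time_from_minorizing_measure
    {𝒳 : Type*} [MeasurableSpace 𝒳]
    (P : Kernel 𝒳 𝒳) [IsMarkovKernel P] (π : Measure 𝒳) [IsProbabilityMeasure π]
    -- π is stationary for P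
    (hstat : ∀ A : Set 𝒳, MeasurableSet A → ∫⁻ z, P z A ∂π = π A)
    -- P is φ-irreducible
    (φ : Measure 𝒳) [SigmaFinite φ] (hφ : φ ≠ 0)
    (hirr : ∀ A : Set 𝒳, MeasurableSet A → 0 < φ A → ∀ x : 𝒳,
        ∃ n : ℕ, 1 ≤ n ∧ 0 < iterK P n x A)
    (B C : Set 𝒳) (hB : MeasurableSet B) (hC : MeasurableSet C)
    (hπB : 0 < π B) (hπC : 0 < π C)
    -- C is small for P with minorizing measure μ₀
    (μ₀ : Measure 𝒳) [IsProbabilityMeasure μ₀]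
    (ε : ℝ≥0∞) (hε : 0 < ε) (n₀ : ℕ) (hn₀ : 1 ≤ n₀)
    (hsmall : ∀ x ∈ C, ∀ A : Set 𝒳, MeasurableSet A → ε * μ₀ A ≤ iterK P n₀ x A)
    -- any realization of the chain started from μ₀
    {Ω : Type*} [MeasurableSpace Ω] (μ : Measure Ω) [IsProbabilityMeasure μ]
    (Y : ℕ → Ω → 𝒳) (hmc : IsMarkovReal P μ₀ μ Y) :
    ∫⁻ ω, hitTime Y B ω ∂μ < ⊤ := by
  have hinv : π.bind P = π := by
    ext A hA
    rw [Measure.bind_apply hA P.aemeasurable, hstat A hA]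
  have hg := measurable_expHit (P := P) hB
  obtain ⟨x, hxC, hx⟩ : ∃ x ∈ C, ∀ n, (kernelAvg P)^[n] (expHit P B) x < ⊤ := by
    have hne : (ae (π.restrict C)).NeBot := by
      rw [ae_neBot, Ne, Measure.restrict_eq_zero]
      exact hπC.ne'
    exact ((ae_restrict_mem hC).and (ae_restrict_of_ae
      (ae_forall_kernelAvg_iterate_expHit_lt_top hinv hφ hirr hB hπB))).exists
  have hle : ε * ∫⁻ y, expHit P B y ∂μ₀ ≤ (kernelAvg P)^[n₀] (expHit P B) x := by
    rw [← lintegral_iterK_s10 hg, ← smul_eq_mul, ← lintegral_smul_measure]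
    exact lintegral_mono' (Measure.le_iff.2 fun A hA => hsmall x hxC A hA) le_rfl
  refine (hmc.lintegral_hitTime_le hB).trans_lt (lt_top_iff_ne_top.2 fun htop => ?_)
  rw [htop, ENNReal.mul_top hε.ne'] at hle
  exact (hx n₀).not_ge hle
end
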